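/- arXiv:2208.09251 — 3 statements merged into one kernel-verified Lean document; each statement's English description precedes it below -/
import Mathlib

section
/- Let n ≥ 3 and let C_n be the cycle graph on vertices [n]. The characteristic polynomial of the connected subgraph arrangement 𝒜_{C_n} is χ(𝒜_{C_n}, t) = (t − 1)(t − n)^{n−1}. -/
open Finset

/-- The linear form `∑_{i ∈ I} x_i` on `ℚ^n`. -/
noncomputable def linForm {n : ℕ} (I : Finset (Fin n)) : (Fin n → ℚ) →ₗ[ℚ] ℚ :=
  ∑ i ∈ I, LinearMap.proj i

/-- `I` is a nonempty subset of vertices inducing a connected subgraph of `G`. -/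
def ConnSet {n : ℕ} (G : SimpleGraph (Fin n)) (I : Finset (Fin n)) : Prop :=
  I.Nonempty ∧ (G.induce (↑I : Set (Fin n))).Connected

/-- The connected subgraph arrangement of `G`, as a set of hyperplanes of `ℚ^n`. -/
def csa {n : ℕ} (G : SimpleGraph (Fin n)) : Set (Submodule ℚ (Fin n → ℚ)) :=
  {H | ∃ I : Finset (Fin n), ConnSet G I ∧ H = LinearMap.ker (linForm I)}

/-- The almost path graph `A_{n,k}` (paper notation, vertices `1,…,n+1` realized as
`Fin (n+1)` with `0,…,n`): a path `1–⋯–n` together with the edge `{k, n+1}`. -/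
def almostPath (n k : ℕ) : SimpleGraph (Fin (n + 1)) :=
  SimpleGraph.fromRel (fun a b =>
    (a.val + 1 = b.val ∧ b.val < n) ∨ (a.val = k - 1 ∧ b.val = n))

/-- The path-with-triangle graph `Δ_{n,k}` (paper notation): a path `1–⋯–n` together
with the edges `{k, n+1}` and `{k+1, n+1}`. -/
def pathTriangle (n k : ℕ) : SimpleGraph (Fin (n + 1)) :=
  SimpleGraph.fromRel (fun a b =>
    (a.val + 1 = b.val ∧ b.val < n) ∨ (a.val = k - 1 ∧ b.val = n) ∨ (a.val = k ∧ b.val = n))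

/-- The module of `𝒜_G`-derivations `D(𝒜_G) ⊆ Der_ℚ(ℚ[x_1,…,x_n])`. -/
noncomputable def derModule {n : ℕ} (G : SimpleGraph (Fin n)) :
    Submodule (MvPolynomial (Fin n) ℚ)
      (Derivation ℚ (MvPolynomial (Fin n) ℚ) (MvPolynomial (Fin n) ℚ)) where
  carrier := {θ | ∀ I : Finset (Fin n), ConnSet G I →
    (∑ i ∈ I, MvPolynomial.X i) ∣ θ (∑ i ∈ I, MvPolynomial.X i)}
  add_mem' := by
    intro a b ha hb I hI
    rw [Derivation.add_apply]
    exact dvd_add (ha I hI) (hb I hI)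
  zero_mem' := by
    intro I hI
    simp
  smul_mem' := by
    intro c θ hθ I hI
    rw [Derivation.smul_apply, smul_eq_mul]
    exact (hθ I hI).mul_left c

open Classical in
/-- The hyperplanes of the connected subgraph arrangement of `G`, as a `Finset`. -/
noncomputable def csaFinset {n : ℕ} (G : SimpleGraph (Fin n)) :
    Finset (Submodule ℚ (Fin n → ℚ)) :=
  (Finset.univ.filter fun I : Finset (Fin n) => ConnSet G I).image fun I =>
    LinearMap.ker (linForm I)

/-- The characteristic polynomial of a (central) arrangement `A` in `ℚ^n`, via
Whitney's formula `χ(A,t) = ∑_{B ⊆ A} (-1)^{|B|} t^{dim ⋂ B}`, which agrees with the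
Möbius-function definition `χ(A,t) = ∑_{X ∈ L(A)} μ(ℚ^n, X) t^{dim X}`
(Orlik–Terao, Lemma 2.55). -/
noncomputable def charPoly {n : ℕ} (A : Finset (Submodule ℚ (Fin n → ℚ))) : Polynomial ℚ :=
  ∑ B ∈ A.powerset, ((-1 : ℚ) ^ B.card) •
    (Polynomial.X ^ (Module.finrank ℚ ↥(⨅ H ∈ B, H)))


def ShiOK {m : ℕ} (y : Fin m → ℕ) : Prop :=
  Function.Injective y ∧ ∀ i j, i < j → y j ≠ y i + 1

lemma shi_chain {m : ℕ} (y : Fin m → ℕ) (hy : ShiOK y) : ∀ (d : ℕ) (i j : Fin m),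
    y j = y i + d + 1 → (∀ t, y i ≤ t → t < y j → ∃ l, y l = t) → j < i := by
  intro d
  induction d with
  | zero =>
    intro i j h _
    rcases lt_trichotomy i j with h1 | h1 | h1
    · exact absurd h (hy.2 i j h1)
    · subst h1; omega
    · exact h1
  | succ d ih =>
    intro i j h hall
    obtain ⟨l, hl⟩ := hall (y i + d + 1) (by omega) (by omega)
    have h1 : l < i := ih i l hl (fun t h2 h3 => hall t h2 (by omega))
    rcases lt_trichotomy l j with h2 | h2 | h2
    · exact absurd (by omega) (hy.2 l j h2)
    · subst h2; omega
    · exact h2.trans h1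

lemma shi_cnt_le {m : ℕ} (y : Fin m → ℕ) (hy : Function.Injective y) (a b : ℕ) :
    #{l | a ≤ y l ∧ y l < b} ≤ b - a := by
  calc #{l | a ≤ y l ∧ y l < b} ≤ #(Finset.Ico a b) :=
        card_le_card_of_injOn y (by intro l hl; simpa using hl) hy.injOn
    _ = b - a := by simp

lemma shi_cnt_split {m : ℕ} (y : Fin m → ℕ) (a b : ℕ) (h : a ≤ b) :
    #{l | y l < b} = #{l | y l < a} + #{l | a ≤ y l ∧ y l < b} := by
  rw [← card_union_of_disjoint]
  · congr 1; ext l; simp; omega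
  · rw [disjoint_filter]; intros; omega

lemma shi_cnt_le' {m : ℕ} (y : Fin m → ℕ) (hy : Function.Injective y) (b : ℕ) :
    #{l | y l < b} ≤ b := by
  have := shi_cnt_le y hy 0 b
  simpa using this

lemma shi_order {m : ℕ} (y : Fin m → ℕ) (hy : ShiOK y) (i j : Fin m) (h : y i < y j) :
    y i - #{l | y l < y i} < y j - #{l | y l < y j} ∨
    (y i - #{l | y l < y i} = y j - #{l | y l < y j} ∧ j < i) := by
  have h1 := shi_cnt_split y (y i) (y j) h.le
  have h2 := shi_cnt_le y hy.1 (y i) (y j)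
  have h3 := shi_cnt_le' y hy.1 (y i)
  have h4 := shi_cnt_le' y hy.1 (y j)
  by_cases h5 : #{l | y i ≤ y l ∧ y l < y j} = y j - y i
  · right
    refine ⟨by omega, ?_⟩
    apply shi_chain y hy (y j - y i - 1) i j (by omega)
    have h6 : Finset.image y {l | y i ≤ y l ∧ y l < y j} = Finset.Ico (y i) (y j) := by
      apply eq_of_subset_of_card_le
      · intro t ht
        simp only [mem_image, mem_filter, mem_univ, true_and] at ht
        obtain ⟨l, hl, rfl⟩ := ht
        simpa using hl
      · rw [card_image_of_injective _ hy.1, h5]; simp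
    intro t ht1 ht2
    have : t ∈ Finset.Ico (y i) (y j) := by simp [ht1, ht2]
    rw [← h6] at this
    simp only [mem_image] at this
    obtain ⟨l, _, hl⟩ := this
    exact ⟨l, hl⟩
  · left; omega

lemma shi_order_iff {m : ℕ} (y : Fin m → ℕ) (hy : ShiOK y) (i j : Fin m) :
    y i < y j ↔ (y i - #{l | y l < y i} < y j - #{l | y l < y j} ∨
    (y i - #{l | y l < y i} = y j - #{l | y l < y j} ∧ j < i)) := by
  refine ⟨shi_order y hy i j, fun h => ?_⟩
  rcases lt_trichotomy (y i) (y j) with h1 | h1 | h1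
  · exact h1
  · have := hy.1 h1; subst this; simp at h
  · have := shi_order y hy j i h1; omega

lemma shi_bound {m N k : ℕ} (hN : N + 1 = m + k) (y : Fin m → ℕ) (hy : ShiOK y)
    (hyN : ∀ i, y i < N) (i : Fin m) : y i - #{l | y l < y i} < k := by
  have h1 := shi_cnt_split y (y i) N (hyN i).le
  have h2 := shi_cnt_le y hy.1 (y i) N
  have h3 := shi_cnt_le' y hy.1 (y i)
  have h4 : #{l | y l < N} = m := by simp [hyN]
  have := hyN i
  omega

/-- rank in the lexicographic order -/
def shiRk {m : ℕ} (g : Fin m → ℕ) (i : Fin m) : ℕ := #{j | g j < g i ∨ (g j = g i ∧ i < j)}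

lemma shiRk_lt {m : ℕ} (g : Fin m → ℕ) (i j : Fin m) (h : g j < g i ∨ (g j = g i ∧ i < j)) :
    shiRk g j < shiRk g i := by
  apply card_lt_card
  rw [Finset.ssubset_iff_of_subset]
  · refine ⟨j, by simpa using h, by simp⟩
  · intro l hl
    simp only [mem_filter, mem_univ, true_and] at hl ⊢
    omega

lemma shiRk_lt_m {m : ℕ} (g : Fin m → ℕ) (i : Fin m) : shiRk g i < m := by
  have : shiRk g i < #(univ : Finset (Fin m)) := by
    apply card_lt_card
    rw [Finset.ssubset_iff_of_subset (subset_univ _)]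
    exact ⟨i, by simp, by simp⟩
  simpa using this

lemma shiRk_iff {m : ℕ} (g : Fin m → ℕ) (i j : Fin m) :
    g j + shiRk g j < g i + shiRk g i ↔ (g j < g i ∨ (g j = g i ∧ i < j)) := by
  constructor
  · intro h
    by_contra h1
    rcases eq_or_ne i j with rfl | hij
    · omega
    · have : g i < g j ∨ (g i = g j ∧ j < i) := by omega
      have := shiRk_lt g j i this
      omega
  · intro h
    have := shiRk_lt g i j h
    omega

lemma shiRk_ok {m : ℕ} (g : Fin m → ℕ) : ShiOK (fun i => g i + shiRk g i) := by
  constructor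
  · intro i j h
    by_contra hij
    have h1 := shiRk_iff g i j
    have h2 := shiRk_iff g j i
    simp only at h
    omega
  · intro i j hij h
    have h1 := (shiRk_iff g j i).1 (by simp only at h; omega)
    have h2 := shiRk_lt g j i h1
    simp only at h; omega

theorem shi_count (m N k : ℕ) (hN : N + 1 = m + k) (_hk : 1 ≤ k) :
    Nat.card {y : Fin m → Fin N // ShiOK (fun i => (y i : ℕ))} = k ^ m := by
  have e : {y : Fin m → Fin N // ShiOK (fun i => (y i : ℕ))} ≃ (Fin m → Fin k) :=
    { toFun := fun y i => ⟨(y.1 i : ℕ) - #{l | (y.1 l : ℕ) < y.1 i},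
        shi_bound hN (fun i => (y.1 i : ℕ)) y.2 (fun i => (y.1 i).2) i⟩
      invFun := fun g => ⟨fun i => ⟨(g i : ℕ) + shiRk (fun j => (g j : ℕ)) i, by
          have := shiRk_lt_m (fun j => (g j : ℕ)) i
          have := (g i).2
          omega⟩, shiRk_ok (fun j => (g j : ℕ))⟩
      left_inv := by
        rintro ⟨y, hy⟩
        apply Subtype.ext
        funext i
        apply Fin.ext
        have h1 : shiRk (fun j => (y j : ℕ) - #{l | (y l : ℕ) < y j}) i
            = #{l | (y l : ℕ) < y i} :=
          congrArg Finset.card (Finset.filter_congr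
            (fun j _ => (shi_order_iff _ hy j i).symm))
        have h3 := shi_cnt_le' _ hy.1 (y i)
        change (y i : ℕ) - #{l | (y l : ℕ) < y i} +
          shiRk (fun j => (y j : ℕ) - #{l | (y l : ℕ) < y j}) i = y i
        rw [h1]
        exact Nat.sub_add_cancel h3
      right_inv := by
        intro g
        funext i
        apply Fin.ext
        have h1 : #{l | (g l : ℕ) + shiRk (fun j => (g j : ℕ)) l <
            (g i : ℕ) + shiRk (fun j => (g j : ℕ)) i} = shiRk (fun j => (g j : ℕ)) i :=
          congrArg Finset.card (Finset.filter_congr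
            (fun j _ => (shiRk_iff (fun j => (g j : ℕ)) i j)))
        change (g i : ℕ) + shiRk (fun j => (g j : ℕ)) i - #{l | (g l : ℕ) +
          shiRk (fun j => (g j : ℕ)) l < (g i : ℕ) + shiRk (fun j => (g j : ℕ)) i} = g i
        rw [h1]
        omega }
  rw [Nat.card_congr e]
  simp

def arc (n a b : ℕ) : Finset (Fin n) := Finset.univ.filter fun i => a ≤ i.val ∧ i.val < b

lemma cyc_adj {n : ℕ} (hn : 3 ≤ n) (u v : Fin n) :
    (SimpleGraph.cycleGraph n).Adj u v ↔ (u.val + 1 = v.val ∨ v.val + 1 = u.val ∨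
      (u.val = 0 ∧ v.val + 1 = n) ∨ (v.val = 0 ∧ u.val + 1 = n)) := by
  rw [SimpleGraph.cycleGraph_adj']
  have key : ∀ u v : Fin n, (u - v).val = 1 ↔
      (v.val + 1 = u.val ∨ (u.val = 0 ∧ v.val + 1 = n)) := by
    intro u v
    have hu := u.2
    have hv := v.2
    rcases le_or_gt v u with h | h
    · rw [Fin.sub_val_of_le h]
      have : v.val ≤ u.val := h
      omega
    · rw [Fin.val_sub]
      have : u.val < v.val := h
      rw [Nat.mod_eq_of_lt (by omega)]
      omega
  rw [key, key]
  tauto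

lemma conn_sep {n : ℕ} (hn : 3 ≤ n) (I : Finset (Fin n))
    (hI : ConnSet (SimpleGraph.cycleGraph n) I) (b d : Fin n) (hb : b ∉ I) (hd : d ∉ I)
    (u v : Fin n) (hu : u ∈ I) (hv : v ∈ I) (hu2 : b < u ∧ u < d) : b < v ∧ v < d := by
  have h := hI.2.preconnected ⟨u, hu⟩ ⟨v, hv⟩
  obtain ⟨w⟩ := h
  have key : ∀ (x y : ((I : Set (Fin n)) : Type)),
      ((SimpleGraph.cycleGraph n).induce (I : Set (Fin n))).Walk x y →
      (b < x.1 ∧ x.1 < d) → (b < y.1 ∧ y.1 < d) := by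
    intro x y w
    induction w with
    | nil => exact id
    | @cons x y z hadj w ih =>
      intro hx
      apply ih
      have h1 : (SimpleGraph.cycleGraph n).Adj x.1 y.1 := hadj
      rw [cyc_adj hn] at h1
      have h2 : y.1 ≠ b := fun h => hb (h ▸ y.2)
      have h3 : y.1 ≠ d := fun h => hd (h ▸ y.2)
      have h4 := d.2
      have h5 := y.1.2
      rw [Ne, Fin.ext_iff] at h2 h3
      rw [Fin.lt_def, Fin.lt_def] at hx ⊢
      omega
  exact key _ _ w hu2

lemma conn_forward {n : ℕ} (hn : 3 ≤ n) (I : Finset (Fin n))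
    (hI : ConnSet (SimpleGraph.cycleGraph n) I) :
    (∃ a b, a < b ∧ b ≤ n ∧ I = arc n a b) ∨
    (∃ a b, 0 < a ∧ a < b ∧ b < n ∧ I = (arc n a b)ᶜ) := by
  have hsep := conn_sep hn I hI
  have hmin := I.min'_mem hI.1
  have hmax := I.max'_mem hI.1
  have hle : ∀ i ∈ I, I.min' hI.1 ≤ i ∧ i ≤ I.max' hI.1 :=
    fun i hi => ⟨I.min'_le i hi, I.le_max' i hi⟩
  set lo := I.min' hI.1
  set hi := I.max' hI.1
  let z : Fin n := ⟨0, by omega⟩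
  let t : Fin n := ⟨n - 1, by omega⟩
  have interval : (∀ w, lo < w → w < hi → w ∈ I) → 
      ∃ a b, a < b ∧ b ≤ n ∧ I = arc n a b := by
    intro hw
    have h1 : lo ≤ hi := (hle _ hmin).2
    refine ⟨lo.val, hi.val + 1, Nat.lt_succ_of_le h1, hi.2, ?_⟩
    ext i
    simp only [arc, mem_filter, mem_univ, true_and]
    constructor
    · intro h
      have := hle i h
      rw [Fin.le_def, Fin.le_def] at this
      omega
    · rintro ⟨h2, h3⟩
      by_cases h4 : i = lo
      · rw [h4]; exact hmin
      by_cases h5 : i = hi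
      · rw [h5]; exact hmax
      apply hw
      · rw [Fin.ext_iff] at h4; rw [Fin.lt_def]; omega
      · rw [Fin.ext_iff] at h5; rw [Fin.lt_def]; omega
  by_cases hz : z ∈ I
  · by_cases ht : t ∈ I
    · by_cases hc : (Iᶜ : Finset (Fin n)).Nonempty
      · right
        have cmin := (Iᶜ).min'_mem hc
        have cmax := (Iᶜ).max'_mem hc
        have cle : ∀ i, i ∉ I → (Iᶜ).min' hc ≤ i ∧ i ≤ (Iᶜ).max' hc :=
          fun i hi => ⟨(Iᶜ).min'_le i (by simpa using hi), (Iᶜ).le_max' i (by simpa using hi)⟩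
        set a := (Iᶜ).min' hc
        set b := (Iᶜ).max' hc
        rw [mem_compl] at cmin cmax
        have ha : a ≠ z := fun h => cmin (h ▸ hz)
        have hb : b ≠ t := fun h => cmax (h ▸ ht)
        rw [Ne, Fin.ext_iff] at ha hb
        have ha' : a.val ≠ 0 := ha
        have hb' : b.val ≠ n - 1 := hb
        have hb2 := b.2
        have hab : a.val ≤ b.val := (cle _ cmin).2
        refine ⟨a.val, b.val + 1, by omega, by omega, by omega, ?_⟩
        ext i
        simp only [arc, mem_compl, mem_filter, mem_univ, true_and]
        constructor
        · rintro h ⟨h1, h2⟩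
          have h3 : i ≠ a := fun h' => cmin (h' ▸ h)
          have h4 : i ≠ b := fun h' => cmax (h' ▸ h)
          rw [Ne, Fin.ext_iff] at h3 h4
          have h5 := hsep a b cmin cmax i z h hz (by rw [Fin.lt_def, Fin.lt_def]; omega)
          have h6 : a.val < 0 := h5.1
          omega
        · intro h
          by_contra h1
          have := cle i h1
          rw [Fin.le_def, Fin.le_def] at this
          omega
      · left
        refine ⟨0, n, by omega, le_rfl, ?_⟩
        ext i
        simp only [arc, mem_filter, mem_univ, true_and]
        refine ⟨fun _ => ⟨by omega, i.2⟩, fun _ => ?_⟩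
        by_contra h
        exact hc ⟨i, by simpa using h⟩
    · left
      apply interval
      intro w h1 h2
      by_contra hw
      have h3 : hi ≠ t := fun h => ht (h ▸ hmax)
      rw [Ne, Fin.ext_iff] at h3
      have h3' : hi.val ≠ n - 1 := h3
      have h4 : hi < t := by
        rw [Fin.lt_def]; change hi.val < n - 1; have := hi.2; omega
      have := (hsep w t hw ht hi lo hmax hmin ⟨h2, h4⟩).1
      exact absurd h1 this.asymm
  · left
    apply interval
    intro w h1 h2
    by_contra hw
    have h3 : lo ≠ z := fun h => hz (h ▸ hmin)
    rw [Ne, Fin.ext_iff] at h3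
    have h3' : lo.val ≠ 0 := h3
    have h4 : z < lo := by
      rw [Fin.lt_def]; change 0 < lo.val; omega
    have := (hsep z w hz hw lo hi hmin hmax ⟨h4, h1⟩).2
    exact absurd h2 this.asymm

lemma conn_reach {n : ℕ} (hn : 3 ≤ n) (I : Finset (Fin n)) : ∀ (k : ℕ) (u v : Fin n)
    (hu : u ∈ I) (hv : v ∈ I), v.val = u.val + k →
    (∀ w : Fin n, u.val ≤ w.val → w.val ≤ v.val → w ∈ I) →
    ((SimpleGraph.cycleGraph n).induce (I : Set (Fin n))).Reachable ⟨u, hu⟩ ⟨v, hv⟩ := by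
  intro k
  induction k with
  | zero =>
    intro u v hu hv h _
    have : u = v := Fin.ext (by omega)
    subst this
    rfl
  | succ k ih =>
    intro u v hu hv h hall
    have hv2 := v.2
    let w : Fin n := ⟨u.val + k, by omega⟩
    have hw : w ∈ I := hall w (by simp [w]) (by simp [w]; omega)
    refine (ih u w hu hw rfl (fun x h1 h2 => hall x h1 (by simp [w] at h2; omega))).trans ?_
    apply SimpleGraph.Adj.reachable
    change (SimpleGraph.cycleGraph n).Adj w v
    rw [cyc_adj hn]
    left
    simp [w]; omega

lemma conn_arc {n : ℕ} (hn : 3 ≤ n) (a b : ℕ) (hab : a < b) (hb : b ≤ n) :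
    ConnSet (SimpleGraph.cycleGraph n) (arc n a b) := by
  have h0 : (⟨a, by omega⟩ : Fin n) ∈ arc n a b := by simp [arc, hab]
  refine ⟨⟨_, h0⟩, ?_⟩
  rw [SimpleGraph.connected_iff_exists_forall_reachable]
  refine ⟨⟨_, h0⟩, ?_⟩
  rintro ⟨v, hv⟩
  have hv' : a ≤ v.val ∧ v.val < b := by simpa [arc] using hv
  apply conn_reach hn _ (v.val - a) _ v h0 hv (by simp; omega)
  intro w h1 h2
  simp at h1
  simp [arc]
  omega

lemma conn_arc_compl {n : ℕ} (hn : 3 ≤ n) (a b : ℕ) (_hab : a < b) (hb : b < n) :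
    ConnSet (SimpleGraph.cycleGraph n) (arc n a b)ᶜ := by
  have h0 : (⟨n - 1, by omega⟩ : Fin n) ∈ (arc n a b)ᶜ := by simp [arc]; omega
  refine ⟨⟨_, h0⟩, ?_⟩
  rw [SimpleGraph.connected_iff_exists_forall_reachable]
  refine ⟨⟨_, h0⟩, ?_⟩
  rintro ⟨v, hv⟩
  have hv' : ¬ (a ≤ v.val ∧ v.val < b) := by simpa [arc] using hv
  have hv2 := v.2
  by_cases h : b ≤ v.val
  · symm
    apply conn_reach hn _ (n - 1 - v.val) v _ hv h0 (by simp; omega)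
    intro w h1 h2
    simp [arc]
    omega
  · have h1 : (⟨0, by omega⟩ : Fin n) ∈ (arc n a b)ᶜ := by simp [arc]; omega
    have h2 : ((SimpleGraph.cycleGraph n).induce (((arc n a b)ᶜ : Finset (Fin n)) :
        Set (Fin n))).Reachable ⟨_, h0⟩ ⟨_, h1⟩ := by
      apply SimpleGraph.Adj.reachable
      change (SimpleGraph.cycleGraph n).Adj _ _
      rw [cyc_adj hn]
      right; right; right
      simp; omega
    refine h2.trans ?_
    apply conn_reach hn _ v.val _ v h1 hv (by simp)
    intro w h1 h2
    simp [arc]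
    omega

def psum {n : ℕ} {F : Type*} [AddCommMonoid F] (x : Fin n → F) (k : ℕ) : F :=
  ∑ i ∈ arc n 0 k, x i

lemma psum_arc {n : ℕ} {F : Type*} [AddCommGroup F] (x : Fin n → F) (a b : ℕ) (h : a ≤ b) :
    ∑ i ∈ arc n a b, x i = psum x b - psum x a := by
  rw [eq_sub_iff_add_eq, psum, psum, ← sum_union]
  · congr 1; ext i; simp [arc]; omega
  · rw [arc, arc, disjoint_filter]; intros; omega

lemma psum_all {n : ℕ} {F : Type*} [AddCommGroup F] (x : Fin n → F) :
    psum x n = ∑ i, x i := by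
  unfold psum; congr 1; ext i; simp [arc]

lemma psum_compl {n : ℕ} {F : Type*} [AddCommGroup F] (x : Fin n → F) (a b : ℕ) (h : a ≤ b) :
    ∑ i ∈ (arc n a b)ᶜ, x i = psum x n - (psum x b - psum x a) := by
  rw [← psum_arc x a b h, psum_all, eq_sub_iff_add_eq, sum_compl_add_sum]

lemma psum_zero {n : ℕ} {F : Type*} [AddCommGroup F] (x : Fin n → F) : psum x 0 = 0 := by
  simp [psum, arc]

lemma psum_succ {n : ℕ} {F : Type*} [AddCommGroup F] (x : Fin n → F) (i : Fin n) :
    psum x (i.val + 1) = psum x i.val + x i := by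
  have h := psum_arc x i.val (i.val + 1) (by omega)
  have h2 : arc n i.val (i.val + 1) = {i} := by
    ext j; simp [arc, Fin.ext_iff]; omega
  rw [h2, sum_singleton] at h
  rw [h]; abel

def GoodX {n : ℕ} {F : Type*} [AddCommGroup F] (x : Fin n → F) : Prop :=
  ∀ I, ConnSet (SimpleGraph.cycleGraph n) I → ∑ i ∈ I, x i ≠ 0

lemma goodX_iff {n : ℕ} (hn : 3 ≤ n) {F : Type*} [AddCommGroup F] (x : Fin n → F) :
    GoodX x ↔ psum x n ≠ 0 ∧ ∀ a b, a < b → b < n →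
      psum x b ≠ psum x a ∧ psum x b - psum x a ≠ psum x n := by
  constructor
  · intro h
    refine ⟨?_, fun a b hab hb => ⟨?_, ?_⟩⟩
    · have := h _ (conn_arc hn 0 n (by omega) le_rfl)
      rwa [psum_arc _ _ _ (by omega), psum_zero, sub_zero] at this
    · have := h _ (conn_arc hn a b hab hb.le)
      rwa [psum_arc _ _ _ hab.le, sub_ne_zero] at this
    · have := h _ (conn_arc_compl hn a b hab hb)
      rw [psum_compl _ _ _ hab.le, sub_ne_zero] at this
      exact this.symm
  · rintro ⟨h0, h⟩ I hI
    rcases conn_forward hn I hI with ⟨a, b, hab, hb, rfl⟩ | ⟨a, b, ha, hab, hb, rfl⟩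
    · rw [psum_arc _ _ _ hab.le]
      rcases hb.lt_or_eq with hb | rfl
      · rw [sub_ne_zero]; exact (h a b hab hb).1
      · rcases Nat.eq_zero_or_pos a with rfl | ha
        · rwa [psum_zero, sub_zero]
        · have := (h 0 a ha hab).2
          rw [psum_zero, sub_zero] at this
          rw [sub_ne_zero]; exact this.symm
    · rw [psum_compl _ _ _ hab.le, sub_ne_zero]
      exact (h a b hab hb).2.symm

lemma zmod_inj {p u v : ℕ} (hu : u < p) (hv : v < p) (h : (u : ZMod p) = v) : u = v := by
  rw [ZMod.natCast_eq_natCast_iff'] at h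
  rwa [Nat.mod_eq_of_lt hu, Nat.mod_eq_of_lt hv] at h

def Zf {m N : ℕ} (w : Fin m → Fin N) (k : ℕ) : ZMod (N + 2) :=
  if k = 0 then 0 else if h : k - 1 < m then (((w ⟨k - 1, h⟩ : ℕ) + 2 : ℕ) : ZMod (N + 2)) else 1

def Xf {m N : ℕ} (s : ZMod (N + 2)) (w : Fin m → Fin N) (i : Fin (m + 1)) : ZMod (N + 2) :=
  s * (Zf w (i.val + 1) - Zf w i.val)

lemma psum_Xf {m N : ℕ} (s : ZMod (N + 2)) (w : Fin m → Fin N) (k : ℕ) (hk : k ≤ m + 1) :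
    psum (Xf s w) k = s * Zf w k := by
  induction k with
  | zero => simp [psum_zero, Zf]
  | succ k ih =>
    have := psum_succ (Xf s w) ⟨k, by omega⟩
    simp only at this
    rw [this, ih (by omega), Xf]
    ring

lemma Zf_last {m N : ℕ} (w : Fin m → Fin N) : Zf w (m + 1) = 1 := by simp [Zf]
lemma Zf_zero {m N : ℕ} (w : Fin m → Fin N) : Zf w 0 = 0 := by simp [Zf]
lemma Zf_mid {m N : ℕ} (w : Fin m → Fin N) (i : Fin m) :
    Zf w (i.val + 1) = (((w i : ℕ) + 2 : ℕ) : ZMod (N + 2)) := by simp [Zf]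

lemma Xf_good {m N : ℕ} (hm : 2 ≤ m) [Fact (N + 2).Prime] (s : ZMod (N + 2)) (hs : s ≠ 0)
    (w : Fin m → Fin N) (hw : ShiOK (fun i => (w i : ℕ))) : GoodX (Xf s w) := by
  rw [goodX_iff (by omega), psum_Xf _ _ _ le_rfl, Zf_last, mul_one]
  refine ⟨hs, fun a b hab hb => ?_⟩
  rw [psum_Xf _ _ _ (by omega), psum_Xf _ _ _ (by omega), ← mul_sub]
  suffices h : Zf w b ≠ Zf w a ∧ Zf w b ≠ Zf w a + 1 by
    refine ⟨fun h1 => h.1 (mul_left_cancel₀ hs h1), fun h1 => h.2 ?_⟩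
    have : Zf w b - Zf w a = 1 := mul_left_cancel₀ hs (h1.trans (mul_one s).symm)
    rw [← this]; ring
  obtain ⟨j, rfl⟩ : ∃ j : Fin m, b = j.val + 1 := ⟨⟨b - 1, by omega⟩, by simp; omega⟩
  rw [Zf_mid]
  have hj := (w j).2
  rcases Nat.eq_zero_or_pos a with rfl | ha
  · rw [Zf_zero]
    constructor
    · intro h
      have := zmod_inj (p := N + 2) (u := (w j : ℕ) + 2) (v := 0) (by omega) (by omega) (by rw [h]; simp)
      omega
    · intro h
      have := zmod_inj (p := N + 2) (u := (w j : ℕ) + 2) (v := 1) (by omega) (by omega) (by rw [h]; simp)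
      omega
  · obtain ⟨i, rfl⟩ : ∃ i : Fin m, a = i.val + 1 := ⟨⟨a - 1, by omega⟩, by simp; omega⟩
    have hi := (w i).2
    have hij : i < j := by rw [Fin.lt_def]; omega
    rw [Zf_mid]
    constructor
    · intro h
      have h1 := zmod_inj (p := N + 2) (by omega) (by omega) h
      have h2 : i = j := hw.1 (show (w i : ℕ) = w j by omega)
      exact hij.ne h2
    · intro h
      by_cases h1 : (w i : ℕ) + 3 < N + 2
      · have h2 := zmod_inj (p := N + 2) (u := (w j : ℕ) + 2) (v := w i + 3) (by omega) h1
          (by rw [h]; push_cast; ring)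
        exact hw.2 i j hij (by simp only; omega)
      · have h3 : (w i : ℕ) + 3 = N + 2 := by omega
        have h2 := zmod_inj (p := N + 2) (u := (w j : ℕ) + 2) (v := 0) (by omega) (by omega) (h.trans (by
          have : (((w i : ℕ) + 3 : ℕ) : ZMod (N + 2)) = 0 := by rw [h3]; exact ZMod.natCast_self _
          rw [Nat.cast_zero, ← this]; push_cast; ring))
        omega

theorem good_count {m N k : ℕ} (hm : 2 ≤ m) [Fact (N + 2).Prime] (hN : N + 1 = m + k)
    (hk : 1 ≤ k) :
    Nat.card {x : Fin (m + 1) → ZMod (N + 2) // GoodX x} = (N + 1) * k ^ m := by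
  have h1 : Nat.card {s : ZMod (N + 2) // s ≠ 0} = N + 1 := by
    rw [Nat.card_eq_fintype_card, Fintype.card_subtype_compl]
    simp [ZMod.card]
  rw [← shi_count m N k hN hk, ← h1, ← Nat.card_prod]
  symm
  apply Nat.card_eq_of_bijective
    (f := fun q => (⟨Xf q.1.1 q.2.1, Xf_good hm q.1.1 q.1.2 q.2.1 q.2.2⟩ :
      {x : Fin (m + 1) → ZMod (N + 2) // GoodX x}))
  constructor
  · rintro ⟨⟨s, hs⟩, ⟨w, hw⟩⟩ ⟨⟨s', hs'⟩, ⟨w', hw'⟩⟩ h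
    have h2 : Xf s w = Xf s' w' := congrArg Subtype.val h
    have h3 : ∀ k ≤ m + 1, s * Zf w k = s' * Zf w' k := fun k hk => by
      rw [← psum_Xf _ _ _ hk, ← psum_Xf _ _ _ hk, h2]
    have h4 : s = s' := by simpa [Zf_last] using h3 (m + 1) le_rfl
    subst h4
    have h5 : w = w' := by
      funext i
      have h6 := mul_left_cancel₀ hs (h3 (i.val + 1) (by omega))
      rw [Zf_mid, Zf_mid] at h6
      have a1 := (w i).2
      have a2 := (w' i).2
      have := zmod_inj (p := N + 2) (by omega) (by omega) h6
      exact Fin.ext (by omega)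
    subst h5
    rfl
  · rintro ⟨x, hx⟩
    have hg := (goodX_iff (by omega) x).1 hx
    obtain ⟨hs, hg⟩ := hg
    set s := psum x (m + 1) with hsdef
    -- normalised partial sums
    let z : ℕ → ZMod (N + 2) := fun k => psum x k / s
    have z0 : z 0 = 0 := by simp [z, psum_zero]
    have z1 : z (m + 1) = 1 := by simp only [z]; rw [← hsdef]; exact div_self hs
    have hz : ∀ k, psum x k = s * z k := fun k => by simp only [z]; field_simp
    have hg' : ∀ a b, a < b → b < m + 1 → z b ≠ z a ∧ z b ≠ z a + 1 := by
      intro a b hab hb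
      have := hg a b hab hb
      rw [hz a, hz b] at this
      refine ⟨fun h => this.1 (by rw [h]), fun h => this.2 (by rw [h]; ring)⟩
    have hval : ∀ k, 0 < k → k < m + 1 → 2 ≤ (z k).val := by
      intro k h1 h2
      have h3 := hg' 0 k h1 h2
      rw [z0, zero_add] at h3
      by_contra h4
      have h5 : (((z k).val : ℕ) : ZMod (N + 2)) = z k := ZMod.natCast_zmod_val _
      have : (z k).val = 0 ∨ (z k).val = 1 := by omega
      rcases this with h6 | h6
      · rw [h6] at h5; exact h3.1 (by rw [← h5]; simp)
      · rw [h6] at h5; exact h3.2 (by rw [← h5]; simp)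
    have hlt : ∀ k, (z k).val < N + 2 := fun k => ZMod.val_lt _
    have hcast : ∀ k, (((z k).val : ℕ) : ZMod (N + 2)) = z k := fun k => ZMod.natCast_zmod_val _
    let w : Fin m → Fin N := fun i => ⟨(z (i.val + 1)).val - 2, by
      have := hlt (i.val + 1)
      have := hval (i.val + 1) (by omega) (by omega)
      omega⟩
    have hwz : ∀ i : Fin m, (w i : ℕ) + 2 = (z (i.val + 1)).val := by
      intro i
      have := hval (i.val + 1) (by omega) (by omega)
      simp only [w]; omega
    have hne : ∀ i j : Fin m, i < j → w i ≠ w j := by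
      intro i j hij h
      rw [Fin.lt_def] at hij
      apply (hg' (i.val + 1) (j.val + 1) (by omega) (by omega)).1
      rw [← hcast, ← hcast (i.val + 1), ← hwz, ← hwz, h]
    have hw : ShiOK (fun i => (w i : ℕ)) := by
      constructor
      · intro i j h
        have h' : w i = w j := Fin.ext h
        rcases lt_trichotomy i j with h1 | h1 | h1
        · exact absurd h' (hne i j h1)
        · exact h1
        · exact absurd h'.symm (hne j i h1)
      · intro i j hij h
        rw [Fin.lt_def] at hij
        apply (hg' (i.val + 1) (j.val + 1) (by omega) (by omega)).2
        rw [← hcast, ← hcast (i.val + 1), ← hwz, ← hwz]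
        simp only at h
        rw [h]; push_cast; ring
    refine ⟨⟨⟨s, hs⟩, ⟨w, hw⟩⟩, Subtype.ext ?_⟩
    have hZ : ∀ k ≤ m + 1, Zf w k = z k := by
      intro k hk
      rcases Nat.eq_zero_or_pos k with rfl | h
      · rw [Zf_zero, z0]
      rcases hk.lt_or_eq with h2 | rfl
      · obtain ⟨i, rfl⟩ : ∃ i : Fin m, k = i.val + 1 := ⟨⟨k - 1, by omega⟩, by simp; omega⟩
        rw [Zf_mid, hwz, hcast]
      · rw [Zf_last, z1]
    funext i
    change s * (Zf w (i.val + 1) - Zf w i.val) = x i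
    rw [hZ _ (by omega), hZ _ (by omega), mul_sub, ← hz, ← hz, psum_succ]
    ring

lemma factor_ker {V W U : Type*} [AddCommGroup V] [Module ℚ V] [AddCommGroup W] [Module ℚ W]
    [AddCommGroup U] [Module ℚ U] (f : V →ₗ[ℚ] W) (g : V →ₗ[ℚ] U)
    (h : LinearMap.ker f ≤ LinearMap.ker g) : ∃ N : W →ₗ[ℚ] U, N ∘ₗ f = g := by
  obtain ⟨N, hN⟩ := LinearMap.exists_extend
    (((LinearMap.ker f).liftQ g h) ∘ₗ f.quotKerEquivRange.symm.toLinearMap)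
  refine ⟨N, ?_⟩
  ext v
  have := LinearMap.congr_fun hN ⟨f v, LinearMap.mem_range_self f v⟩
  simp only [LinearMap.comp_apply, Submodule.subtype_apply] at this
  rw [LinearMap.comp_apply, this]
  have h2 : f.quotKerEquivRange.symm ⟨f v, LinearMap.mem_range_self f v⟩
      = (LinearMap.ker f).mkQ v := by
    rw [LinearEquiv.symm_apply_eq]
    rfl
  change ((LinearMap.ker f).liftQ g h) (f.quotKerEquivRange.symm _) = _
  rw [h2]
  simp

lemma ker_split {r n : ℕ} (M : Matrix (Fin r) (Fin n) ℚ) :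
    ∃ (A : Matrix (Fin n) (Fin (Module.finrank ℚ (LinearMap.ker (Matrix.toLin' M)))) ℚ)
      (L : Matrix (Fin (Module.finrank ℚ (LinearMap.ker (Matrix.toLin' M)))) (Fin n) ℚ)
      (N : Matrix (Fin n) (Fin r) ℚ), M * A = 0 ∧ L * A = 1 ∧ A * L + N * M = 1 := by
  set f := Matrix.toLin' M with hf
  let e := (Module.finBasis ℚ (LinearMap.ker f)).equivFun
  obtain ⟨L, hL⟩ := LinearMap.exists_extend e.toLinearMap
  let A := (LinearMap.ker f).subtype ∘ₗ e.symm.toLinearMap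
  have hfA : f ∘ₗ A = 0 := by
    ext v; simp [A]
  have hLA : L ∘ₗ A = LinearMap.id := by
    rw [← LinearMap.comp_assoc, hL]; ext v; simp
  obtain ⟨N, hN⟩ := factor_ker f (LinearMap.id - A ∘ₗ L) (by
    intro v hv
    have := LinearMap.congr_fun hL ⟨v, hv⟩
    simp only [LinearMap.comp_apply, Submodule.subtype_apply] at this
    rw [LinearMap.mem_ker]
    simp [A, this])
  have hM : LinearMap.toMatrix' f = M := by rw [hf, LinearMap.toMatrix'_toLin']
  refine ⟨LinearMap.toMatrix' A, LinearMap.toMatrix' L, LinearMap.toMatrix' N, ?_, ?_, ?_⟩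
  · rw [← hM, ← LinearMap.toMatrix'_comp, hfA]; simp
  · rw [← LinearMap.toMatrix'_comp, hLA, LinearMap.toMatrix'_id]
  · rw [← hM, ← LinearMap.toMatrix'_comp, ← LinearMap.toMatrix'_comp, hN, ← map_add]
    simp

lemma clear_denom {a b : ℕ} (A : Matrix (Fin a) (Fin b) ℚ) :
    ∃ (D : ℤ) (A' : Matrix (Fin a) (Fin b) ℤ), D ≠ 0 ∧
      A'.map (Int.cast : ℤ → ℚ) = (D : ℚ) • A := by
  obtain ⟨D, hD⟩ := IsLocalization.exist_integer_multiples_of_finite (nonZeroDivisors ℤ)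
    (fun q : Fin a × Fin b => A q.1 q.2)
  choose g hg using hD
  refine ⟨D, Matrix.of fun i j => g (i, j), nonZeroDivisors.ne_zero D.2, ?_⟩
  ext i j
  have := hg (i, j)
  rw [Matrix.map_apply, Matrix.smul_apply, Matrix.of_apply]
  simpa using this

lemma imap_smul (R : Type*) [CommRing R] {u v : ℕ} (k : ℤ) (P : Matrix (Fin u) (Fin v) ℤ) :
    (k • P).map (Int.cast : ℤ → R) = (k : R) • P.map (Int.cast : ℤ → R) := by
  ext i j
  rw [Matrix.map_apply, Matrix.smul_apply, Matrix.smul_apply, Matrix.map_apply, smul_eq_mul,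
    smul_eq_mul, Int.cast_mul]

lemma imap_add (R : Type*) [CommRing R] {u v : ℕ} (P Q : Matrix (Fin u) (Fin v) ℤ) :
    (P + Q).map (Int.cast : ℤ → R) =
      P.map (Int.cast : ℤ → R) + Q.map (Int.cast : ℤ → R) := by
  ext i j
  rw [Matrix.map_apply, Matrix.add_apply, Matrix.add_apply, Matrix.map_apply, Matrix.map_apply,
    Int.cast_add]

lemma imap_one (R : Type*) [CommRing R] (u : ℕ) :
    (1 : Matrix (Fin u) (Fin u) ℤ).map (Int.cast : ℤ → R) = 1 :=
  Matrix.map_one _ Int.cast_zero Int.cast_one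

lemma imap_zero (R : Type*) [CommRing R] (u v : ℕ) :
    (0 : Matrix (Fin u) (Fin v) ℤ).map (Int.cast : ℤ → R) = 0 :=
  Matrix.map_zero _ Int.cast_zero

lemma imap_mul (R : Type*) [CommRing R] {u v w : ℕ} (P : Matrix (Fin u) (Fin v) ℤ)
    (Q : Matrix (Fin v) (Fin w) ℤ) : (P * Q).map (Int.cast : ℤ → R) =
      P.map (Int.cast : ℤ → R) * Q.map (Int.cast : ℤ → R) :=
  Matrix.map_mul (f := Int.castRingHom R)

lemma rank_count_matrix {r n : ℕ} (M : Matrix (Fin r) (Fin n) ℤ) :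
    ∃ D : ℤ, D ≠ 0 ∧ ∀ p : ℕ, p.Prime → ¬ ((p : ℤ) ∣ D) →
      Nat.card {x : Fin n → ZMod p // (M.map (Int.cast : ℤ → ZMod p)).mulVec x = 0} =
        p ^ Module.finrank ℚ (LinearMap.ker (Matrix.toLin' (M.map (Int.cast : ℤ → ℚ)))) := by
  obtain ⟨A, L, N, h1, h2, h3⟩ := ker_split (M.map (Int.cast : ℤ → ℚ))
  obtain ⟨a, A', ha, hA⟩ := clear_denom A
  obtain ⟨l, L', hl, hL⟩ := clear_denom L
  obtain ⟨c, N', hc, hN⟩ := clear_denom N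
  have inj : ∀ {u v : ℕ} (P Q : Matrix (Fin u) (Fin v) ℤ),
      P.map (Int.cast : ℤ → ℚ) = Q.map (Int.cast : ℤ → ℚ) → P = Q := by
    intro u v P Q h
    exact Matrix.map_injective Int.cast_injective h
  have e1 : M * A' = 0 := by
    apply inj; rw [imap_mul, hA, Matrix.mul_smul, h1, smul_zero, imap_zero]
  have e2 : L' * A' = (l * a) • (1 : Matrix _ _ ℤ) := by
    apply inj
    rw [imap_mul, hA, hL, Matrix.mul_smul, Matrix.smul_mul, h2, imap_smul, imap_one, smul_smul,
      Int.cast_mul, mul_comm]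
  have e3 : c • (A' * L') + (a * l) • (N' * M) = (a * l * c) • (1 : Matrix _ _ ℤ) := by
    apply inj
    rw [imap_add, imap_smul, imap_smul, imap_smul, imap_one, imap_mul, imap_mul, hA, hL, hN,
      Matrix.mul_smul, Matrix.smul_mul, Matrix.smul_mul, ← h3, smul_add, smul_smul, smul_smul,
      smul_smul]
    push_cast
    congr 2; ring
  refine ⟨a * l * c, by positivity, ?_⟩
  intro p hp hD
  have : Fact p.Prime := ⟨hp⟩
  have hD' : ((a : ZMod p) * l * c) ≠ 0 := by
    intro h
    apply hD
    rw [← ZMod.intCast_zmod_eq_zero_iff_dvd]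
    · push_cast; exact h
  have f1 := congrArg (fun P => Matrix.map P (Int.cast : ℤ → ZMod p)) e1
  have f2 := congrArg (fun P => Matrix.map P (Int.cast : ℤ → ZMod p)) e2
  have f3 := congrArg (fun P => Matrix.map P (Int.cast : ℤ → ZMod p)) e3
  simp only [imap_mul, imap_zero, imap_add, imap_smul, imap_one, Int.cast_mul] at f1 f2 f3
  generalize M.map (Int.cast : ℤ → ZMod p) = Mp at f1 f2 f3 ⊢
  generalize A'.map (Int.cast : ℤ → ZMod p) = Ap at f1 f2 f3
  generalize L'.map (Int.cast : ℤ → ZMod p) = Lp at f1 f2 f3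
  generalize N'.map (Int.cast : ℤ → ZMod p) = Np at f1 f2 f3
  have hal : (a : ZMod p) * l ≠ 0 := left_ne_zero_of_mul hD'
  have hcp : (c : ZMod p) ≠ 0 := right_ne_zero_of_mul hD'
  have e : {x : Fin n → ZMod p // Mp.mulVec x = 0} ≃
      (Fin (Module.finrank ℚ (LinearMap.ker
        (Matrix.toLin' (M.map (Int.cast : ℤ → ℚ))))) → ZMod p) :=
    { toFun := fun x => ((a : ZMod p) * l)⁻¹ • Lp.mulVec x.1
      invFun := fun y => ⟨Ap.mulVec y, by rw [Matrix.mulVec_mulVec, f1]; simp⟩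
      left_inv := by
        rintro ⟨x, hx⟩
        apply Subtype.ext
        simp only
        rw [Matrix.mulVec_smul, Matrix.mulVec_mulVec]
        have h5 := congrArg (fun P => P.mulVec x) f3
        simp only [Matrix.add_mulVec, Matrix.smul_mulVec, ← Matrix.mulVec_mulVec x Np Mp, hx,
          Matrix.mulVec_zero, smul_zero, add_zero, Matrix.one_mulVec] at h5
        have h6 : (Ap * Lp).mulVec x = ((a : ZMod p) * l) • x := by
          apply smul_right_injective _ hcp
          simp only
          rw [h5, smul_smul]; congr 1; ring
        rw [h6, smul_smul, inv_mul_cancel₀ hal, one_smul]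
      right_inv := by
        intro y
        simp only
        rw [Matrix.mulVec_mulVec, f2, Matrix.smul_mulVec, Matrix.one_mulVec, smul_smul,
          mul_comm (l : ZMod p), inv_mul_cancel₀ hal, one_smul] }
  rw [Nat.card_congr e]
  simp [ZMod.card]

lemma rank_count {n : ℕ} (S : Finset (Finset (Fin n))) :
    ∃ D : ℤ, D ≠ 0 ∧ ∀ p : ℕ, p.Prime → ¬ ((p : ℤ) ∣ D) →
      Nat.card {x : Fin n → ZMod p // ∀ I ∈ S, ∑ i ∈ I, x i = 0} =
        p ^ Module.finrank ℚ ↥(⨅ I ∈ S, LinearMap.ker (linForm I)) := by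
  classical
  let e := S.equivFin.symm
  let M : Matrix (Fin #S) (Fin n) ℤ := fun r i => if i ∈ (e r).1 then 1 else 0
  have hM : ∀ (R : Type) [CommRing R] (x : Fin n → R),
      (M.map (Int.cast : ℤ → R)).mulVec x = 0 ↔ ∀ I ∈ S, ∑ i ∈ I, x i = 0 := by
    intro R _ x
    have h1 : ∀ r, (M.map (Int.cast : ℤ → R)).mulVec x r = ∑ i ∈ (e r).1, x i := by
      intro r
      have h2 : ∀ i, (M.map (Int.cast : ℤ → R)) r i = if i ∈ (e r).1 then 1 else 0 := by
        intro i
        rw [Matrix.map_apply]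
        change ((if i ∈ (e r).1 then 1 else 0 : ℤ) : R) = _
        split_ifs <;> simp
      simp only [Matrix.mulVec, dotProduct, h2]
      simp
    constructor
    · intro h I hI
      have := congrFun h (e.symm ⟨I, hI⟩)
      rw [h1] at this
      simpa using this
    · intro h
      funext r
      rw [h1]
      exact h _ (e r).2
  obtain ⟨D, hD, h⟩ := rank_count_matrix M
  refine ⟨D, hD, fun p hp hpD => ?_⟩
  have h1 := h p hp hpD
  simp only [hM] at h1
  rw [h1]
  have h2 : LinearMap.ker (Matrix.toLin' (M.map (Int.cast : ℤ → ℚ))) =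
      ⨅ I ∈ S, LinearMap.ker (linForm I) := by
    ext x
    rw [LinearMap.mem_ker, Matrix.toLin'_apply, hM ℚ x]
    simp [Submodule.mem_iInf, linForm]
  rw [h2]

lemma ker_linForm_injective {n : ℕ} :
    Function.Injective (fun I : Finset (Fin n) => LinearMap.ker (linForm I)) := by
  classical
  have key : ∀ I J : Finset (Fin n), LinearMap.ker (linForm I) = LinearMap.ker (linForm J) →
      I ⊆ J := by
    intro I J h i hi
    by_contra hj
    have h1 : (Pi.single i 1 : Fin n → ℚ) ∈ LinearMap.ker (linForm J) := by
      simp [linForm, Pi.single_apply, hj]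
    rw [← h] at h1
    simp [linForm, Pi.single_apply, hi] at h1
  intro I J h
  exact (key I J h).antisymm (key J I h.symm)

lemma incl_excl {n p : ℕ} [NeZero p] (T : Finset (Finset (Fin n))) :
    (∑ S ∈ T.powerset, (-1 : ℚ) ^ #S *
      (Nat.card {x : Fin n → ZMod p // ∀ I ∈ S, ∑ i ∈ I, x i = 0} : ℚ)) =
    (Nat.card {x : Fin n → ZMod p // ∀ I ∈ T, ∑ i ∈ I, x i ≠ 0} : ℚ) := by
  classical
  have hc : ∀ P : (Fin n → ZMod p) → Prop, (Nat.card {x // P x} : ℚ) =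
      ∑ x, if P x then (1 : ℚ) else 0 := by
    intro P
    rw [Nat.card_eq_fintype_card, Fintype.card_subtype]
    simp
  simp_rw [hc, mul_sum]
  rw [sum_comm]
  apply sum_congr rfl
  intro x _
  have h1 : ∀ S : Finset (Finset (Fin n)), (-1 : ℚ) ^ #S *
      (if ∀ I ∈ S, ∑ i ∈ I, x i = 0 then 1 else 0) =
      ∏ I ∈ S, (if ∑ i ∈ I, x i = 0 then (-1 : ℚ) else 0) := by
    intro S
    split_ifs with h
    · rw [mul_one, ← prod_const]
      exact prod_congr rfl (fun I hI => by rw [if_pos (h I hI)])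
    · push Not at h
      obtain ⟨I, hI, hI2⟩ := h
      rw [mul_zero, prod_eq_zero hI]
      rw [if_neg hI2]
  trans ∑ S ∈ T.powerset, ∏ I ∈ S, (if ∑ i ∈ I, x i = 0 then (-1 : ℚ) else 0)
  · apply sum_congr rfl
    intro S _
    rw [← h1 S]
    congr
  rw [← prod_one_add]
  split_ifs with h
  · exact prod_eq_one (fun I hI => by rw [if_neg (h I hI)]; simp)
  · push Not at h
    obtain ⟨I, hI, hI2⟩ := h
    rw [prod_eq_zero hI]
    rw [if_pos hI2]; simp

open Classical in
lemma charPoly_eq {n : ℕ} (G : SimpleGraph (Fin n)) :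
    charPoly (csaFinset G) = ∑ S ∈ (univ.filter fun I => ConnSet G I).powerset,
      ((-1 : ℚ) ^ #S) • (Polynomial.X ^ (Module.finrank ℚ
        ↥(⨅ I ∈ S, LinearMap.ker (linForm I))) : Polynomial ℚ) := by
  unfold charPoly csaFinset
  rw [powerset_image, sum_image]
  · apply sum_congr rfl
    intro S _
    rw [card_image_of_injective _ ker_linForm_injective]
    have : (⨅ H ∈ S.image (fun I => LinearMap.ker (linForm I)), H) =
        ⨅ I ∈ S, LinearMap.ker (linForm I) := by
      ext x; simp [Submodule.mem_iInf]
    rw [this]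
  · exact (image_injective ker_linForm_injective).injOn

/-- For `n ≥ 3`, the characteristic polynomial of the connected
subgraph arrangement of the cycle graph `C_n` is `(t − 1)(t − n)^{n−1}`. -/
theorem csa_cycle_charPoly (n : ℕ) (hn : 3 ≤ n) :
    charPoly (csaFinset (SimpleGraph.cycleGraph n)) =
      (Polynomial.X - 1) * (Polynomial.X - Polynomial.C (n : ℚ)) ^ (n - 1) := by
  classical
  obtain ⟨m, rfl⟩ : ∃ m, n = m + 1 := ⟨n - 1, by omega⟩
  choose D hD0 hD using (rank_count (n := m + 1))
  rw [charPoly_eq]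
  set T : Finset (Finset (Fin (m + 1))) :=
    univ.filter fun I => ConnSet (SimpleGraph.cycleGraph (m + 1)) I with hT
  let E : ℤ := ∏ S ∈ T.powerset, D S
  have hE : E ≠ 0 := prod_ne_zero_iff.2 fun S _ => hD0 S
  apply Polynomial.eq_of_infinite_eval_eq
  have hinf : {p : ℕ | p.Prime ∧ E.natAbs + m + 2 < p}.Infinite := by
    rw [Set.infinite_iff_exists_gt]
    intro a
    obtain ⟨p, hp, hp2⟩ := Nat.exists_infinite_primes (a + E.natAbs + m + 3)
    exact ⟨p, ⟨hp2, by omega⟩, by omega⟩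
  refine (hinf.image (f := fun p : ℕ => (p : ℚ)) Nat.cast_injective.injOn).mono ?_
  rintro _ ⟨p, ⟨hp, hlt⟩, rfl⟩
  have hpE : ¬ ((p : ℤ) ∣ E) := by
    intro h
    have := Nat.le_of_dvd (Int.natAbs_pos.2 hE) (Int.natCast_dvd.1 h)
    omega
  obtain ⟨N, rfl⟩ : ∃ N, p = N + 2 := ⟨p - 2, by omega⟩
  have : Fact (N + 2).Prime := ⟨hp⟩
  have hsum := incl_excl (p := N + 2) T
  have hcount := good_count (m := m) (N := N) (k := N + 1 - m) (by omega) (by omega) (by omega)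
  have hgood : Nat.card {x : Fin (m + 1) → ZMod (N + 2) // ∀ I ∈ T, ∑ i ∈ I, x i ≠ 0} =
      Nat.card {x : Fin (m + 1) → ZMod (N + 2) // GoodX x} := by
    apply Nat.card_congr
    apply Equiv.subtypeEquivRight
    intro x
    simp [hT, GoodX]
  rw [hgood, hcount] at hsum
  simp only [Set.mem_ofPred_eq, Polynomial.eval_finsetSum, Polynomial.eval_smul,
    Polynomial.eval_pow, Polynomial.eval_X, Polynomial.eval_mul, Polynomial.eval_sub,
    Polynomial.eval_one, Polynomial.eval_C, smul_eq_mul, Nat.add_sub_cancel]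
  have h1 : ∀ S ∈ T.powerset, (-1 : ℚ) ^ #S * ((N + 2 : ℕ) : ℚ) ^ (Module.finrank ℚ
      ↥(⨅ I ∈ S, LinearMap.ker (linForm I))) = (-1 : ℚ) ^ #S *
      (Nat.card {x : Fin (m + 1) → ZMod (N + 2) // ∀ I ∈ S, ∑ i ∈ I, x i = 0} : ℚ) := by
    intro S hS
    rw [hD S (N + 2) hp (fun h => hpE (h.trans (dvd_prod_of_mem D hS)))]
    push_cast
    rfl
  rw [sum_congr rfl h1, hsum]
  have h2 : ((N + 1 - m : ℕ) : ℚ) = N + 1 - m := by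
    rw [Nat.cast_sub (by omega)]; push_cast; ring
  push_cast [h2]
  ring
end

section
/- Let n ≥ 3 and let C_n be the cycle graph on vertices [n]. The complement ℝ^n ∖ ⋃_{I} {x ∈ ℝ^n : ∑_{i∈I} x_i = 0}, where I ranges over the nonempty subsets of [n] inducing a connected subgraph of C_n, has exactly 2(n+1)^{n−1} connected components. -/
open Finset

/-- The complement in `ℝ^n` of the union of the (real) hyperplanes
`{x : ∑_{i ∈ I} x_i = 0}` of the connected subgraph arrangement of `G`. -/
def realCompl {n : ℕ} (G : SimpleGraph (Fin n)) : Set (Fin n → ℝ) :=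
  {x | ∀ I : Finset (Fin n), ConnSet G I → ∑ i ∈ I, x i ≠ 0}


namespace CsaAux

/-- A gain hyperplane `x a - x b = d`, stored as `(a, b, d)`. -/
def ev {ι R : Type} [CommRing R] (h : ι × ι × ℤ) (x : ι → R) : R := x h.1 - x h.2.1 - (h.2.2 : R)

/-- Complement of a gain arrangement. -/
def cpl {ι : Type} (R : Type) [CommRing R] (S : List (ι × ι × ℤ)) : Set (ι → R) :=
  {x | ∀ h ∈ S, ev h x ≠ 0}

/-- Sign vector. -/
noncomputable def sig {ι : Type} (S : List (ι × ι × ℤ)) (x : ι → ℝ) : List Bool :=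
  S.map (fun h => decide (0 < ev h x))

/-- Number of regions. -/
noncomputable def reg {ι : Type} (S : List (ι × ι × ℤ)) : ℕ := (sig S '' cpl ℝ S).ncard

theorem sig_eq_iff {ι : Type} (S : List (ι × ι × ℤ)) (x y : ι → ℝ) :
    sig S x = sig S y ↔ ∀ h ∈ S, (0 < ev h x ↔ 0 < ev h y) := by
  simp [sig]

theorem sig_finite {ι : Type} (S : List (ι × ι × ℤ)) (A : Set (ι → ℝ)) : (sig S '' A).Finite := by
  refine (List.finite_length_eq Bool S.length).subset ?_
  rintro _ ⟨x, _, rfl⟩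
  simp [sig]

theorem cpl_cons {ι : Type} (R : Type) [CommRing R] (h : ι × ι × ℤ) (S : List (ι × ι × ℤ))
    (x : ι → R) : x ∈ cpl R (h :: S) ↔ ev h x ≠ 0 ∧ x ∈ cpl R S := by
  simp [cpl]

theorem ncard_image_eq {X Y A B : Type} (φ : X → A) (ψ : Y → B) (s : Set X) (t : Set Y)
    (f : X → Y) (hf : ∀ x ∈ s, f x ∈ t)
    (h1 : ∀ x ∈ s, ∀ x' ∈ s, (φ x = φ x' ↔ ψ (f x) = ψ (f x')))
    (h2 : ∀ y ∈ t, ∃ x ∈ s, ψ (f x) = ψ y) : (φ '' s).ncard = (ψ '' t).ncard := by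
  classical
  have hc : ∀ a ∈ φ '' s, ∃ x ∈ s, φ x = a := fun a ha => ha
  choose g hg1 hg2 using hc
  refine Set.ncard_congr (fun a ha => ψ (f (g a ha))) ?_ ?_ ?_
  · intro a ha
    exact ⟨_, hf _ (hg1 a ha), rfl⟩
  · intro a b ha hb hab
    rw [← hg2 a ha, ← hg2 b hb]
    exact (h1 _ (hg1 a ha) _ (hg1 b hb)).2 hab
  · rintro _ ⟨y, hy, rfl⟩
    obtain ⟨x, hx, hxy⟩ := h2 y hy
    have hm : φ x ∈ φ '' s := ⟨x, hx, rfl⟩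
    exact ⟨φ x, hm, by rw [← hxy]; exact (h1 _ (hg1 _ hm) _ hx).1 (hg2 _ hm)⟩

theorem ev_line {ι : Type} (h : ι × ι × ℤ) (x v : ι → ℝ) (t : ℝ) :
    ev h (fun k => x k + t * v k) = ev h x + t * (v h.1 - v h.2.1) := by
  simp only [ev]; ring

/-- Moving a little along a line does not change the region. -/
theorem perturb {ι : Type} (S : List (ι × ι × ℤ)) (x v : ι → ℝ) (hx : x ∈ cpl ℝ S) :
    ∃ ε > 0, ∀ t : ℝ, |t| ≤ ε → (fun k => x k + t * v k) ∈ cpl ℝ S ∧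
      sig S (fun k => x k + t * v k) = sig S x := by
  induction S with
  | nil => exact ⟨1, one_pos, by simp [cpl, sig]⟩
  | cons h S ih =>
    rw [cpl_cons] at hx
    obtain ⟨ε, hε, H⟩ := ih hx.2
    set a := ev h x with ha
    set w := v h.1 - v h.2.1 with hw
    have hpa : 0 < |a| := abs_pos.2 hx.1
    have hpw : 0 < |w| + 1 := by positivity
    refine ⟨min ε (|a| / (2 * (|w| + 1))), by positivity, fun t ht => ?_⟩
    have ht1 := H t (ht.trans (min_le_left _ _))
    have ht2 : |t| ≤ |a| / (2 * (|w| + 1)) := ht.trans (min_le_right _ _)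
    have hb : |t * w| < |a| := by
      rw [abs_mul]
      rw [le_div_iff₀ (by positivity)] at ht2
      nlinarith [abs_nonneg t, abs_nonneg w]
    have hb' := abs_lt.1 hb
    have hs : (0 < a + t * w ↔ 0 < a) ∧ a + t * w ≠ 0 := by
      rcases lt_or_gt_of_ne hx.1 with h0 | h0
      · rw [abs_of_neg h0] at hb'
        exact ⟨⟨fun _ => by linarith, fun _ => by linarith⟩, by linarith⟩
      · rw [abs_of_pos h0] at hb'
        exact ⟨⟨fun _ => by linarith, fun _ => by linarith⟩, by linarith⟩
    constructor
    · rw [cpl_cons, ev_line]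
      exact ⟨hs.2, ht1.1⟩
    · have := ht1.2
      rw [sig_eq_iff] at this ⊢
      intro h' hh'
      rcases List.mem_cons.1 hh' with rfl | hh'
      · rw [ev_line]; exact hs.1
      · exact this h' hh'

theorem segment_same {ι : Type} (S : List (ι × ι × ℤ)) (x y : ι → ℝ) (hx : x ∈ cpl ℝ S)
    (hy : y ∈ cpl ℝ S) (hxy : sig S x = sig S y) (t : ℝ) (h0 : 0 ≤ t) (h1 : t ≤ 1) :
    (fun k => x k + t * (y k - x k)) ∈ cpl ℝ S ∧
      sig S (fun k => x k + t * (y k - x k)) = sig S x := by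
  rw [sig_eq_iff] at hxy ⊢
  have key : ∀ h ∈ S, ev h (fun k => x k + t * (y k - x k)) ≠ 0 ∧
      (0 < ev h (fun k => x k + t * (y k - x k)) ↔ 0 < ev h x) := by
    intro h hh
    have e : ev h (fun k => x k + t * (y k - x k)) = (1 - t) * ev h x + t * ev h y := by
      simp only [ev]; ring
    rw [e]
    have a1 := hx h hh
    have a2 := hy h hh
    have a3 := hxy h hh
    rcases lt_or_gt_of_ne a1 with b | b
    · have b2 : ev h y < 0 := lt_of_le_of_ne (not_lt.1 (fun c => absurd (a3.2 c) (by linarith))) a2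
      have : (1 - t) * ev h x + t * ev h y < 0 := by
        rcases eq_or_lt_of_le h0 with rfl | h0
        · simpa using b
        · nlinarith
      exact ⟨this.ne, ⟨fun c => by linarith, fun c => by linarith⟩⟩
    · have b2 : 0 < ev h y := a3.1 b
      have : 0 < (1 - t) * ev h x + t * ev h y := by
        rcases eq_or_lt_of_le h0 with rfl | h0
        · simpa using b
        · nlinarith
      exact ⟨this.ne', ⟨fun c => b, fun c => this⟩⟩
  exact ⟨fun h hh => (key h hh).1, fun h hh => (key h hh).2⟩

section restrict
variable {ι : Type} [DecidableEq ι]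

/-- Projection of the variables after eliminating `x j = x i - c`. -/
def prj (i j : ι) (hij : i ≠ j) (k : ι) : {k : ι // k ≠ j} :=
  if h : k = j then ⟨i, hij⟩ else ⟨k, h⟩

/-- Restriction of hyperplanes. -/
def rst (i j : ι) (hij : i ≠ j) (c : ℤ) (h : ι × ι × ℤ) :
    {k : ι // k ≠ j} × {k : ι // k ≠ j} × ℤ :=
  (prj i j hij h.1, prj i j hij h.2.1,
    h.2.2 + (if h.1 = j then c else 0) - (if h.2.1 = j then c else 0))

/-- Parametrization of the hyperplane. -/
def ext {R : Type} [CommRing R] (i j : ι) (hij : i ≠ j) (c : ℤ) (y : {k : ι // k ≠ j} → R) :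
    ι → R := fun k => y (prj i j hij k) - (if k = j then (c : R) else 0)

theorem ev_rst {R : Type} [CommRing R] (i j : ι) (hij : i ≠ j) (c : ℤ) (h : ι × ι × ℤ)
    (y : {k : ι // k ≠ j} → R) : ev (rst i j hij c h) y = ev h (ext i j hij c y) := by
  simp only [ev, rst, ext]
  split_ifs <;> push_cast <;> ring

theorem ev_ext {R : Type} [CommRing R] (i j : ι) (hij : i ≠ j) (c : ℤ)
    (y : {k : ι // k ≠ j} → R) : ev (i, j, c) (ext i j hij c y) = 0 := by
  simp [ev, ext, prj, hij]

theorem ext_res {R : Type} [CommRing R] (i j : ι) (hij : i ≠ j) (c : ℤ)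
    (x : ι → R) (hx : ev (i, j, c) x = 0) : ext i j hij c (fun k => x k.1) = x := by
  funext k
  simp only [ev] at hx
  by_cases h : k = j
  · subst h
    simp only [ext, prj]
    simp
    linear_combination hx
  · simp [ext, prj, h]

theorem res_ext {R : Type} [CommRing R] (i j : ι) (hij : i ≠ j) (c : ℤ)
    (y : {k : ι // k ≠ j} → R) : (fun k : {k : ι // k ≠ j} => ext i j hij c y k.1) = y := by
  funext k
  simp [ext, prj, k.2]

theorem cpl_rst {R : Type} [CommRing R] (i j : ι) (hij : i ≠ j) (c : ℤ)
    (S : List (ι × ι × ℤ)) (y : {k : ι // k ≠ j} → R) :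
    y ∈ cpl R (S.map (rst i j hij c)) ↔ ext i j hij c y ∈ cpl R S := by
  simp only [cpl, Set.mem_ofPred_eq, List.forall_mem_map, ev_rst]

theorem sig_rst (i j : ι) (hij : i ≠ j) (c : ℤ)
    (S : List (ι × ι × ℤ)) (y : {k : ι // k ≠ j} → ℝ) :
    sig (S.map (rst i j hij c)) y = sig S (ext i j hij c y) := by
  simp [sig, ev_rst]

theorem reg_rst (i j : ι) (hij : i ≠ j) (c : ℤ) (S : List (ι × ι × ℤ)) :
    reg (S.map (rst i j hij c)) = (sig S '' {x | x ∈ cpl ℝ S ∧ ev (i, j, c) x = 0}).ncard := by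
  unfold reg
  congr 1
  ext v
  constructor
  · rintro ⟨y, hy, rfl⟩
    exact ⟨ext i j hij c y, ⟨(cpl_rst ..).1 hy, ev_ext ..⟩, (sig_rst ..).symm⟩
  · rintro ⟨x, ⟨hx, hx0⟩, rfl⟩
    refine ⟨fun k => x k.1, ?_, ?_⟩
    · rw [cpl_rst, ext_res i j hij c x hx0]; exact hx
    · rw [sig_rst, ext_res i j hij c x hx0]

theorem reg_cons (i j : ι) (hij : i ≠ j) (c : ℤ) (S : List (ι × ι × ℤ)) :
    reg ((i, j, c) :: S) = reg S + reg (S.map (rst i j hij c)) := by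
  set H : ι × ι × ℤ := (i, j, c) with hH
  set Ap := sig S '' {x | x ∈ cpl ℝ S ∧ 0 < ev H x} with hAp
  set Am := sig S '' {x | x ∈ cpl ℝ S ∧ ev H x < 0} with hAm
  have fp : Ap.Finite := sig_finite _ _
  have fm : Am.Finite := sig_finite _ _
  have evl : ∀ (x : ι → ℝ) (t : ℝ), ev H (fun k => x k + t * (if k = i then 1 else 0)) =
      ev H x + t := by
    intro x t
    rw [ev_line H x (fun k => if k = i then 1 else 0)]
    simp [hH, hij.symm]
  have h1 : sig (H :: S) '' cpl ℝ (H :: S) = (List.cons true '' Ap) ∪ (List.cons false '' Am) := by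
    ext v
    constructor
    · rintro ⟨x, hx, rfl⟩
      rw [cpl_cons] at hx
      rcases lt_or_gt_of_ne hx.1 with h | h
      · right
        refine ⟨sig S x, ⟨x, ⟨hx.2, h⟩, rfl⟩, ?_⟩
        simp [sig, h.le]
      · left
        refine ⟨sig S x, ⟨x, ⟨hx.2, h⟩, rfl⟩, ?_⟩
        have h' : 0 < ev H x := h
        simp [sig, h']
    · rintro (⟨_, ⟨x, ⟨hx, h⟩, rfl⟩, rfl⟩ | ⟨_, ⟨x, ⟨hx, h⟩, rfl⟩, rfl⟩)
      · refine ⟨x, (cpl_cons ..).2 ⟨h.ne', hx⟩, ?_⟩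
        simp [sig, h]
      · refine ⟨x, (cpl_cons ..).2 ⟨h.ne, hx⟩, ?_⟩
        simp [sig, h.le]
  have h2 : Ap ∪ Am = sig S '' cpl ℝ S := by
    apply Set.Subset.antisymm
    · rintro _ (⟨x, ⟨hx, h⟩, rfl⟩ | ⟨x, ⟨hx, h⟩, rfl⟩) <;> exact ⟨x, hx, rfl⟩
    · rintro _ ⟨x, hx, rfl⟩
      rcases lt_trichotomy (ev H x) 0 with h | h | h
      · right; exact ⟨x, ⟨hx, h⟩, rfl⟩
      · left
        obtain ⟨ε, hε, hp⟩ := perturb S x (fun k => if k = i then 1 else 0) hx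
        have := hp ε (abs_of_pos hε).le
        exact ⟨_, ⟨this.1, by rw [evl, h]; simpa using hε⟩, this.2⟩
      · left; exact ⟨x, ⟨hx, h⟩, rfl⟩
  have h3 : Ap ∩ Am = sig S '' {x | x ∈ cpl ℝ S ∧ ev H x = 0} := by
    apply Set.Subset.antisymm
    · rintro v ⟨⟨x, ⟨hx, h⟩, rfl⟩, ⟨y, ⟨hy, h'⟩, hxy⟩⟩
      have hd : 0 < ev H x - ev H y := by linarith
      have := segment_same S x y hx hy hxy.symm (ev H x / (ev H x - ev H y)) (by positivity)
        (by rw [div_le_one hd]; linarith)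
      refine ⟨_, ⟨this.1, ?_⟩, this.2⟩
      rw [ev_line H x (fun k => y k - x k)]
      have e : y H.1 - x H.1 - (y H.2.1 - x H.2.1) = - (ev H x - ev H y) := by
        simp only [ev]; ring
      rw [e]
      field_simp
      ring
    · rintro _ ⟨x, ⟨hx, h⟩, rfl⟩
      obtain ⟨ε, hε, hp⟩ := perturb S x (fun k => if k = i then 1 else 0) hx
      have a1 := hp ε (abs_of_pos hε).le
      have a2 := hp (-ε) (by rw [abs_neg]; exact (abs_of_pos hε).le)
      refine ⟨⟨_, ⟨a1.1, by rw [evl, h]; simpa using hε⟩, a1.2⟩,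
        ⟨_, ⟨a2.1, by rw [evl, h]; simpa using hε⟩, a2.2⟩⟩
  rw [reg_rst, ← h3, reg, h1, reg, ← h2, Set.ncard_union_add_ncard_inter _ _ fp fm,
    Set.ncard_union_eq _ (fp.image _) (fm.image _),
    Set.ncard_image_of_injective Ap List.cons_injective,
    Set.ncard_image_of_injective Am List.cons_injective]
  · rw [Set.disjoint_left]
    rintro _ ⟨a, _, rfl⟩ ⟨b, _, hb⟩
    simp at hb

theorem cnt_cons [Fintype ι] (R : Type) [CommRing R] [Fintype R] (i j : ι) (hij : i ≠ j) (c : ℤ)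
    (S : List (ι × ι × ℤ)) :
    (cpl R ((i, j, c) :: S)).ncard + (cpl R (S.map (rst i j hij c))).ncard = (cpl R S).ncard := by
  classical
  have e : (cpl R (S.map (rst i j hij c))).ncard =
      ({x | x ∈ cpl R S ∧ ev (i, j, c) x = 0}).ncard := by
    refine Set.ncard_congr (fun y _ => ext i j hij c y) ?_ ?_ ?_
    · intro y hy
      exact ⟨(cpl_rst ..).1 hy, ev_ext ..⟩
    · intro y z _ _ hyz
      have := congrArg (fun (x : ι → R) => (fun k : {k : ι // k ≠ j} => x k.1)) hyz
      simpa only [res_ext] using this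
    · rintro x ⟨hx, hx0⟩
      refine ⟨fun k => x k.1, ?_, ext_res i j hij c x hx0⟩
      rw [cpl_rst, ext_res i j hij c x hx0]; exact hx
  rw [e, ← Set.ncard_union_eq _ (Set.toFinite _) (Set.toFinite _)]
  · congr 1
    ext x
    simp only [Set.mem_union, cpl_cons, Set.mem_ofPred_eq]
    tauto
  · rw [Set.disjoint_left]
    intro x hx hx'
    rw [cpl_cons] at hx
    exact hx.1 hx'.2

end restrict

/-- The finite field method for gain arrangements. -/
theorem finite_field (m : ℕ) : ∀ (ι : Type) [Fintype ι] (S : List (ι × ι × ℤ)), S.length = m →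
    ∃ P : Polynomial ℤ, (∃ Q : ℕ, ∀ q : ℕ, Q ≤ q → ((cpl (ZMod q) S).ncard : ℤ) = P.eval (q : ℤ)) ∧
      (reg S : ℤ) = (-1) ^ (Fintype.card ι) * P.eval (-1) := by
  classical
  induction m with
  | zero =>
    intro ι _ S hS
    obtain rfl := List.length_eq_zero_iff.1 hS
    refine ⟨Polynomial.X ^ Fintype.card ι, ⟨1, fun q hq => ?_⟩, ?_⟩
    · have : NeZero q := ⟨by omega⟩
      have : cpl (ZMod q) ([] : List (ι × ι × ℤ)) = Set.univ := by ext; simp [cpl]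
      rw [this, Set.ncard_univ, Nat.card_eq_fintype_card]
      simp [ZMod.card]
    · have : cpl ℝ ([] : List (ι × ι × ℤ)) = Set.univ := by ext; simp [cpl]
      have h2 : sig ([] : List (ι × ι × ℤ)) = fun _ => [] := by ext; simp [sig]
      rw [reg, this, h2]
      simp [← mul_pow]
  | succ m ih =>
    intro ι _ S hS
    obtain ⟨⟨i, j, c⟩, S, rfl⟩ := List.exists_cons_of_length_eq_add_one hS
    simp only [List.length_cons, Nat.add_right_cancel_iff] at hS
    obtain ⟨P, ⟨Q, hQ⟩, hP⟩ := ih ι S hS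
    by_cases hij : i = j
    · subst hij
      by_cases hc : c = 0
      · subst hc
        have : ∀ (R : Type) [CommRing R], cpl R ((i, i, 0) :: S) = ∅ := by
          intro R _
          ext x
          rw [cpl_cons]
          simp [ev]
        refine ⟨0, ⟨0, fun q _ => by rw [this]; simp⟩, ?_⟩
        rw [reg, this]; simp
      · refine ⟨P, ⟨max Q (c.natAbs + 1), fun q hq => ?_⟩, ?_⟩
        · rw [← hQ q ((le_max_left _ _).trans hq)]
          congr 2
          ext x
          rw [cpl_cons]
          simp only [ev, sub_self, zero_sub, ne_eq, neg_eq_zero, and_iff_right_iff_imp]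
          intro _
          rw [ZMod.intCast_zmod_eq_zero_iff_dvd]
          intro h
          have := Int.natAbs_dvd_natAbs.2 h
          have := Nat.le_of_dvd (by omega) this
          have := (le_max_right _ _).trans hq
          simp at *
          omega
        · rw [← hP]
          have hcp : cpl ℝ ((i, i, c) :: S) = cpl ℝ S := by
            ext x
            rw [cpl_cons]
            simp [ev, hc]
          congr 1
          unfold reg
          refine ncard_image_eq _ _ _ _ id (fun x hx => hcp ▸ hx) ?_
            (fun y hy => ⟨y, hcp ▸ hy, rfl⟩)
          intro x _ y _
          simp [sig_eq_iff, ev]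
    · obtain ⟨P', ⟨Q', hQ'⟩, hP'⟩ := ih {k : ι // k ≠ j} (S.map (rst i j hij c)) (by simpa using hS)
      refine ⟨P - P', ⟨max (max Q Q') 1, fun q hq => ?_⟩, ?_⟩
      · have h1 : Q ≤ q := by omega
        have h2 : Q' ≤ q := by omega
        have : NeZero q := ⟨by omega⟩
        rw [Polynomial.eval_sub, ← hQ q h1, ← hQ' q h2, ← cnt_cons (ZMod q) i j hij c S]
        push_cast; ring
      · have hcard : Fintype.card ι = Fintype.card {k : ι // k ≠ j} + 1 := by
          have := Fintype.card_pos_iff.2 ⟨j⟩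
          rw [Fintype.card_subtype_compl, Fintype.card_subtype_eq]
          omega
        rw [reg_cons i j hij c S]
        push_cast
        rw [hP, hP', hcard, Polynomial.eval_sub]
        ring

end CsaAux

namespace CsaAux

/-- Linear admissible placements. -/
def plc (n q : ℕ) : Set (Fin n → ℕ) :=
  {x | (∀ i, 1 ≤ x i ∧ x i < q) ∧ ∀ i j, i < j → x j ≠ x i ∧ x j ≠ x i + 1}

/-- rank -/
def rk {n : ℕ} (x : Fin n → ℕ) (i : Fin n) : ℕ := #{j | x j < x i}

/-- lexicographic order -/
def lx {n : ℕ} (d : Fin n → ℕ) (j i : Fin n) : Prop := d j < d i ∨ (d j = d i ∧ i < j)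

instance {n : ℕ} (d : Fin n → ℕ) (j i : Fin n) : Decidable (lx d j i) := by
  unfold lx; infer_instance

/-- lexicographic rank -/
def lrk {n : ℕ} (d : Fin n → ℕ) (i : Fin n) : ℕ := #{j | lx d j i}

theorem lx_total {n : ℕ} (d : Fin n → ℕ) (i j : Fin n) (h : i ≠ j) : lx d i j ∨ lx d j i := by
  unfold lx; omega

theorem lx_irrefl {n : ℕ} (d : Fin n → ℕ) (i : Fin n) : ¬ lx d i i := by
  unfold lx; omega

theorem lx_trans {n : ℕ} (d : Fin n → ℕ) (i j k : Fin n) (h : lx d i j) (h' : lx d j k) :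
    lx d i k := by
  unfold lx at *; omega

theorem lrk_lt {n : ℕ} (d : Fin n → ℕ) (j i : Fin n) (h : lx d j i) : lrk d j < lrk d i := by
  apply Finset.card_lt_card
  rw [Finset.ssubset_iff_of_subset]
  · exact ⟨j, by simpa using h, by simpa using lx_irrefl d j⟩
  · intro k hk
    simp only [mem_filter, mem_univ, true_and] at *
    exact lx_trans d k j i hk h

theorem lrk_bound {n : ℕ} (d : Fin n → ℕ) (i : Fin n) : lrk d i < n := by
  have : lrk d i < #(univ : Finset (Fin n)) := by
    apply Finset.card_lt_card
    rw [Finset.ssubset_iff_of_subset (Finset.subset_univ _)]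
    exact ⟨i, mem_univ _, by simpa using lx_irrefl d i⟩
  simpa using this

/-- placement from boxes -/
def toX {n : ℕ} (d : Fin n → ℕ) (i : Fin n) : ℕ := 1 + d i + lrk d i

theorem toX_lt {n : ℕ} (d : Fin n → ℕ) (j i : Fin n) (h : lx d j i) : toX d j < toX d i := by
  have h1 := lrk_lt d j i h
  unfold toX
  unfold lx at h
  omega

theorem toX_lt_iff {n : ℕ} (d : Fin n → ℕ) (j i : Fin n) : toX d j < toX d i ↔ lx d j i := by
  refine ⟨fun h => ?_, toX_lt d j i⟩
  by_contra hc
  have hne : j ≠ i := by rintro rfl; omega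
  have := toX_lt d i j ((lx_total d j i hne).resolve_left hc)
  omega

theorem toX_mem {n q : ℕ} (d : Fin n → ℕ) (hd : ∀ i, d i < q - n) : toX d ∈ plc n q := by
  refine ⟨fun i => ?_, fun i j hij => ?_⟩
  · have := lrk_bound d i
    have := hd i
    unfold toX; omega
  · have hne : i ≠ j := hij.ne
    rcases lx_total d i j hne with h | h
    · have h1 := lrk_lt d i j h
      unfold lx at h
      unfold toX
      omega
    · have := toX_lt d j i h
      omega

theorem rk_toX {n : ℕ} (d : Fin n → ℕ) (i : Fin n) : rk (toX d) i = lrk d i := by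
  unfold rk lrk
  simp only [toX_lt_iff]

/-- boxes from placement -/
def toD {n : ℕ} (x : Fin n → ℕ) (i : Fin n) : ℕ := x i - 1 - rk x i

theorem plc_inj {n q : ℕ} (x : Fin n → ℕ) (hx : x ∈ plc n q) : Function.Injective x := by
  intro i j h
  rcases lt_trichotomy i j with h' | h' | h'
  · exact absurd h.symm (hx.2 i j h').1
  · exact h'
  · exact absurd h (hx.2 j i h').1

theorem rk_le {n q : ℕ} (x : Fin n → ℕ) (hx : x ∈ plc n q) (i : Fin n) : rk x i + 1 ≤ x i := by
  have h : rk x i ≤ #(Finset.Ico 1 (x i)) := by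
    apply Finset.card_le_card_of_injOn x
    · intro j hj
      simp only [coe_filter, mem_univ, true_and] at hj
      have hj' : x j < x i := hj
      simp only [coe_Ico, Set.mem_Ico]
      exact ⟨(hx.1 j).1, hj'⟩
    · exact (plc_inj x hx).injOn
  have := (hx.1 i).1
  simp at h
  omega

theorem rk_ge {n q : ℕ} (x : Fin n → ℕ) (hx : x ∈ plc n q) (i : Fin n) :
    n + x i ≤ rk x i + q := by
  have h : #{j | x i ≤ x j} ≤ #(Finset.Ico (x i) q) := by
    apply Finset.card_le_card_of_injOn x
    · intro j hj
      simp only [coe_filter, mem_univ, true_and] at hj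
      have hj' : x i ≤ x j := hj
      simp only [coe_Ico, Set.mem_Ico]
      exact ⟨hj', (hx.1 j).2⟩
    · exact (plc_inj x hx).injOn
  have h2 : rk x i + #{j | x i ≤ x j} = n := by
    have := Finset.card_filter_add_card_filter_not (s := (univ : Finset (Fin n)))
      (fun j => x j < x i)
    simp only [not_lt, card_univ, Fintype.card_fin] at this
    exact this
  have := (hx.1 i).2
  simp at h
  omega

theorem toD_lx {n q : ℕ} (x : Fin n → ℕ) (hx : x ∈ plc n q) (j i : Fin n) (h : x j < x i) :
    lx (toD x) j i := by
  have hinj := plc_inj x hx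
  have e1 : rk x i = rk x j + #{k | x j ≤ x k ∧ x k < x i} := by
    unfold rk
    rw [← Finset.card_union_of_disjoint]
    · congr 1
      ext k
      simp only [mem_filter, mem_univ, true_and, mem_union]
      omega
    · rw [Finset.disjoint_left]
      intro k
      simp only [mem_filter, mem_univ, true_and]
      omega
  have himg : (Finset.image x {k | x j ≤ x k ∧ x k < x i}) ⊆ Finset.Ico (x j) (x i) := by
    intro v
    simp only [mem_image, mem_filter, mem_univ, true_and, Finset.mem_Ico]
    rintro ⟨k, hk, rfl⟩
    exact hk
  have hci : #(Finset.image x {k | x j ≤ x k ∧ x k < x i}) = #{k | x j ≤ x k ∧ x k < x i} :=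
    Finset.card_image_of_injective _ hinj
  have e2 : #{k | x j ≤ x k ∧ x k < x i} ≤ x i - x j := by
    rw [← hci]
    simpa using Finset.card_le_card himg
  have b1 := rk_le x hx i
  have b2 := rk_le x hx j
  by_cases hlt : toD x j < toD x i
  · exact Or.inl hlt
  right
  have heq : #{k | x j ≤ x k ∧ x k < x i} = x i - x j := by
    unfold toD at hlt
    omega
  refine ⟨by unfold toD; omega, ?_⟩
  have hfull : Finset.image x {k | x j ≤ x k ∧ x k < x i} = Finset.Ico (x j) (x i) := by
    apply Finset.eq_of_subset_of_card_le himg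
    rw [hci, heq]; simp
  have chain : ∀ t : ℕ, x j + t ≤ x i → ∃ k, x k = x j + t ∧ k ≤ j := by
    intro t
    induction t with
    | zero => exact fun _ => ⟨j, rfl, le_rfl⟩
    | succ t ih =>
      intro ht
      obtain ⟨k, hk, hkj⟩ := ih (by omega)
      obtain ⟨k', hk'⟩ : ∃ k', x k' = x j + (t + 1) := by
        rcases eq_or_lt_of_le ht with h' | h'
        · exact ⟨i, h'.symm⟩
        · have : x j + (t + 1) ∈ Finset.Ico (x j) (x i) := by
            rw [Finset.mem_Ico]; omega
          rw [← hfull, mem_image] at this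
          obtain ⟨k', _, hk'⟩ := this
          exact ⟨k', hk'⟩
      refine ⟨k', hk', ?_⟩
      by_contra hc
      have hlt' : k < k' := lt_of_le_of_lt hkj (not_le.1 hc)
      have := (hx.2 k k' hlt').2
      omega
  obtain ⟨k, hk, hkj⟩ := chain (x i - x j) (by omega)
  have : k = i := hinj (by omega)
  subst this
  rcases eq_or_lt_of_le hkj with h' | h'
  · subst h'; omega
  · exact h'

theorem lrk_toD {n q : ℕ} (x : Fin n → ℕ) (hx : x ∈ plc n q) (i : Fin n) :
    lrk (toD x) i = rk x i := by
  unfold rk lrk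
  congr 1
  ext j
  simp only [mem_filter, mem_univ, true_and]
  refine ⟨fun h => ?_, toD_lx x hx j i⟩
  by_contra hc
  have hne : j ≠ i := by rintro rfl; exact lx_irrefl _ _ h
  have hx' : x j ≠ x i := fun h => hne (plc_inj x hx h)
  have := toD_lx x hx i j (by omega)
  exact lx_irrefl _ _ (lx_trans _ _ _ _ h this)

theorem plc_card (n q : ℕ) : (plc n q).ncard = (q - n) ^ n := by
  have h0 : (Set.univ : Set (Fin n → Fin (q - n))).ncard = (q - n) ^ n := by
    rw [Set.ncard_univ, Nat.card_eq_fintype_card]; simp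
  rw [← h0]
  symm
  refine Set.ncard_congr (fun d _ => toX (fun i => (d i : ℕ))) ?_ ?_ ?_
  · intro d _
    exact toX_mem _ (fun i => (d i).2)
  · intro d d' _ _ h
    have h : toX (fun i => (d i : ℕ)) = toX (fun i => (d' i : ℕ)) := h
    funext i
    have e1 := rk_toX (fun i => (d i : ℕ)) i
    have e2 := rk_toX (fun i => (d' i : ℕ)) i
    have e3 := congrFun h i
    rw [h] at e1
    unfold toX at e3
    have e4 : 1 + (d i : ℕ) + lrk (fun i => (d i : ℕ)) i =
      1 + (d' i : ℕ) + lrk (fun i => (d' i : ℕ)) i := e3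
    ext
    omega
  · intro x hx
    have hb : ∀ i, toD x i < q - n := by
      intro i
      have := rk_le x hx i
      have := rk_ge x hx i
      have := (hx.1 i).2
      unfold toD
      omega
    refine ⟨fun i => ⟨toD x i, hb i⟩, Set.mem_univ _, ?_⟩
    funext i
    show 1 + toD x i + lrk (toD x) i = x i
    rw [lrk_toD x hx]
    have := rk_le x hx i
    unfold toD
    omega

/-- Shi-type placements in `ZMod q`. -/
def shz (n q : ℕ) : Set (Fin n → ZMod q) :=
  {x | ∀ i j, i < j → x j - x i ≠ 0 ∧ x j - x i ≠ 1}

theorem shz_zero (n q : ℕ) (hq : 2 ≤ q) :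
    {x | x ∈ shz n q ∧ ∀ i, x i ≠ 0}.ncard = (q - n) ^ n := by
  have : NeZero q := ⟨by omega⟩
  rw [← plc_card]
  have cast_lt : ∀ a b : ℕ, a < q → b < q → ((a : ZMod q) = b) → a = b := by
    intro a b ha hb h
    have := congrArg ZMod.val h
    rwa [ZMod.val_cast_of_lt ha, ZMod.val_cast_of_lt hb] at this
  refine Set.ncard_congr (fun x _ i => (x i).val) ?_ ?_ ?_
  · rintro x ⟨hx, h0⟩
    refine ⟨fun i => ⟨?_, ZMod.val_lt _⟩, fun i j hij => ⟨?_, ?_⟩⟩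
    · have : (x i).val ≠ 0 := by simpa using h0 i
      show 1 ≤ (x i).val
      omega
    · intro h
      exact (hx i j hij).1 (by rw [ZMod.val_injective q h]; simp)
    · intro h
      have h : (x j).val = (x i).val + 1 := h
      apply (hx i j hij).2
      have := congrArg (fun a : ℕ => (a : ZMod q)) h
      simp only [ZMod.natCast_zmod_val, Nat.cast_add, Nat.cast_one] at this
      rw [this]; ring
  · intro x y _ _ h
    funext i
    exact ZMod.val_injective q (congrFun h i)
  · intro x hx
    refine ⟨fun i => (x i : ZMod q), ⟨?_, ?_⟩, ?_⟩
    · intro i j hij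
      have hi := hx.1 i
      have hj := hx.1 j
      have h := hx.2 i j hij
      constructor
      · intro hc
        exact h.1 (cast_lt _ _ hj.2 hi.2 (sub_eq_zero.1 hc))
      · intro hc
        have hc' : ((x j : ℕ) : ZMod q) = ((x i + 1 : ℕ) : ZMod q) := by
          push_cast; linear_combination hc
        by_cases hl : x i + 1 < q
        · exact h.2 (cast_lt _ _ hj.2 hl hc')
        · have : x i + 1 = q := by omega
          rw [this, ZMod.natCast_self] at hc'
          have := cast_lt (x j) 0 hj.2 (by omega) (by simpa using hc')
          omega
    · intro i hc
      have := cast_lt (x i) 0 (hx.1 i).2 (by omega) (by simpa using hc)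
      have := (hx.1 i).1
      omega
    · funext i
      exact ZMod.val_cast_of_lt (hx.1 i).2

theorem shz_shift (n q : ℕ) (hq : 2 ≤ q) (e : ZMod q) :
    {x | x ∈ shz n q ∧ ∀ i, x i ≠ e}.ncard = (q - n) ^ n := by
  rw [← shz_zero n q hq]
  refine Set.ncard_congr (fun x _ i => x i - e) ?_ ?_ ?_
  · rintro x ⟨hx, h⟩
    refine ⟨fun i j hij => ?_, fun i => sub_ne_zero.2 (h i)⟩
    simpa using hx i j hij
  · intro x y _ _ h
    funext i
    simpa using congrFun h i
  · rintro x ⟨hx, h⟩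
    refine ⟨fun i => x i + e, ⟨fun i j hij => ?_, fun i => ?_⟩, ?_⟩
    · simpa using hx i j hij
    · simpa using h i
    · simp

theorem shz_inj {n q : ℕ} (x : Fin n → ZMod q) (hx : x ∈ shz n q) : Function.Injective x := by
  intro i j h
  rcases lt_trichotomy i j with h' | h' | h'
  · exact absurd (by rw [h]; simp) (hx i j h').1
  · exact h'
  · exact absurd (by rw [h]; simp) (hx j i h').1

theorem shz_card (n q : ℕ) (hn : 1 ≤ n) (hq : n + 1 ≤ q) :
    (shz n q).ncard = q * (q - n) ^ (n - 1) := by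
  classical
  have : NeZero q := ⟨by omega⟩
  have hdc := Finset.sum_card_bipartiteAbove_eq_sum_card_bipartiteBelow
    (s := (shz n q).toFinset) (t := (univ : Finset (ZMod q))) (fun x e => ∀ i, x i ≠ e)
  have h1 : ∀ x ∈ (shz n q).toFinset,
      #(Finset.bipartiteAbove (fun (x : Fin n → ZMod q) e => ∀ i, x i ≠ e) univ x) = q - n := by
    intro x hx
    have hx' : x ∈ shz n q := by simpa using hx
    have : Finset.bipartiteAbove (fun (x : Fin n → ZMod q) e => ∀ i, x i ≠ e) univ x =
        (Finset.image x univ)ᶜ := by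
      ext e
      simp [Finset.bipartiteAbove]
    rw [this, Finset.card_compl, Finset.card_image_of_injective _ (shz_inj x hx')]
    simp [ZMod.card]
  have h2 : ∀ e ∈ (univ : Finset (ZMod q)),
      #(Finset.bipartiteBelow (fun (x : Fin n → ZMod q) e => ∀ i, x i ≠ e)
        (shz n q).toFinset e) = (q - n) ^ n := by
    intro e _
    rw [← shz_shift n q (by omega) e, Set.ncard_eq_toFinset_card']
    congr 1
    ext x
    simp [Finset.bipartiteBelow]
  rw [Finset.sum_congr rfl h1, Finset.sum_congr rfl h2, Finset.sum_const, Finset.sum_const] at hdc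
  rw [Set.ncard_eq_toFinset_card']
  simp only [smul_eq_mul, card_univ, ZMod.card] at hdc
  obtain ⟨k, rfl⟩ : ∃ k, n = k + 1 := ⟨n - 1, by omega⟩
  have hpos : 0 < q - (k + 1) := by omega
  apply Nat.eq_of_mul_eq_mul_right hpos
  rw [hdc, Nat.add_sub_cancel]
  ring

end CsaAux

namespace CsaAux

/-- The Shi arrangement as a list of gain hyperplanes. -/
noncomputable def shi (n : ℕ) : List (Fin n × Fin n × ℤ) :=
  (((univ : Finset (Fin n)) ×ˢ ((univ : Finset (Fin n)) ×ˢ ({0, 1} : Finset ℤ))).filter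
    (fun h => h.2.1 < h.1)).toList

theorem mem_shi (n : ℕ) (h : Fin n × Fin n × ℤ) :
    h ∈ shi n ↔ (h.2.2 = 0 ∨ h.2.2 = 1) ∧ h.2.1 < h.1 := by
  simp [shi]

theorem forall_shi (n : ℕ) (p : Fin n × Fin n × ℤ → Prop) :
    (∀ h ∈ shi n, p h) ↔ ∀ i j, i < j → p (j, i, 0) ∧ p (j, i, 1) := by
  constructor
  · intro H i j hij
    exact ⟨H _ ((mem_shi ..).2 ⟨Or.inl rfl, hij⟩), H _ ((mem_shi ..).2 ⟨Or.inr rfl, hij⟩)⟩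
  · rintro H ⟨j, i, c⟩ hh
    rw [mem_shi] at hh
    obtain ⟨h | h, hij⟩ := hh
    · simp only at h; subst h; exact (H i j hij).1
    · simp only at h; subst h; exact (H i j hij).2

theorem reg_shi (n : ℕ) (hn : 1 ≤ n) : reg (shi n) = (n + 1) ^ (n - 1) := by
  obtain ⟨P, ⟨Q, hQ⟩, hP⟩ := finite_field _ (Fin n) (shi n) rfl
  have hc : ∀ q : ℕ, cpl (ZMod q) (shi n) = shz n q := by
    intro q
    ext x
    simp only [cpl, shz, Set.mem_ofPred_eq, forall_shi]
    simp [ev, sub_eq_zero]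
  have hpoly : P = Polynomial.X * (Polynomial.X - Polynomial.C (n : ℤ)) ^ (n - 1) := by
    apply Polynomial.eq_of_infinite_eval_eq
    have hinf : (Set.range (fun k : ℕ => ((k + (Q + n + 1) : ℕ) : ℤ))).Infinite := by
      apply Set.infinite_range_of_injective
      intro a b hab
      simp only at hab
      have : a + (Q + n + 1) = b + (Q + n + 1) := by exact_mod_cast hab
      omega
    refine hinf.mono ?_
    rintro _ ⟨k, rfl⟩
    show Polynomial.eval _ P = _
    simp only
    rw [← hQ _ (by omega), hc, shz_card n _ hn (by omega)]
    simp only [Polynomial.eval_mul, Polynomial.eval_X, Polynomial.eval_pow, Polynomial.eval_sub,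
      Polynomial.eval_C]
    rw [Nat.cast_mul, Nat.cast_pow, Nat.cast_sub (by omega)]
  rw [hpoly] at hP
  simp only [Polynomial.eval_mul, Polynomial.eval_X, Polynomial.eval_pow, Polynomial.eval_sub,
      Polynomial.eval_C, Fintype.card_fin] at hP
  obtain ⟨k, rfl⟩ : ∃ k, n = k + 1 := ⟨n - 1, by omega⟩
  rw [Nat.add_sub_cancel] at *
  zify
  rw [hP]
  have : (-1 : ℤ) - ((k + 1 : ℕ) : ℤ) = (-1) * (((k + 1 : ℕ) : ℤ) + 1) := by ring
  rw [this, mul_pow]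
  have h1 : ((-1 : ℤ) ^ k) * (-1) ^ k = 1 := by rw [← mul_pow]; simp
  push_cast
  linear_combination ((k : ℤ) + 1 + 1) ^ k * h1

/-! ### Chambers and sign vectors -/

/-- Positive connected sets. -/
def sg {n : ℕ} (G : SimpleGraph (Fin n)) (x : Fin n → ℝ) : Set (Finset (Fin n)) :=
  {I | ConnSet G I ∧ 0 < ∑ i ∈ I, x i}

theorem sg_eq_iff {n : ℕ} (G : SimpleGraph (Fin n)) (x y : Fin n → ℝ) :
    sg G x = sg G y ↔ ∀ I, ConnSet G I → (0 < ∑ i ∈ I, x i ↔ 0 < ∑ i ∈ I, y i) := by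
  simp only [sg, Set.ext_iff, Set.mem_ofPred_eq]
  exact ⟨fun h I hI => by simpa [hI] using h I, fun h I => by
    by_cases hI : ConnSet G I
    · simpa [hI] using h I hI
    · simp [hI]⟩

theorem sg_fiber_convex {n : ℕ} (G : SimpleGraph (Fin n)) (x : Fin n → ℝ) :
    Convex ℝ {z | z ∈ realCompl G ∧ sg G z = sg G x} := by
  have : {z | z ∈ realCompl G ∧ sg G z = sg G x} =
      ⋂ I : Finset (Fin n), {z : Fin n → ℝ | ConnSet G I →
        ∑ i ∈ I, z i ≠ 0 ∧ (0 < ∑ i ∈ I, z i ↔ 0 < ∑ i ∈ I, x i)} := by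
    ext z
    simp only [Set.mem_iInter, Set.mem_ofPred_eq, sg_eq_iff, realCompl]
    exact ⟨fun h I hI => ⟨h.1 I hI, h.2 I hI⟩, fun h => ⟨fun I hI => (h I hI).1,
      fun I hI => (h I hI).2⟩⟩
  rw [this]
  refine convex_iInter fun I => ?_
  intro z hz w hw a b ha hb hab hI
  obtain ⟨z1, z2⟩ := hz hI
  obtain ⟨w1, w2⟩ := hw hI
  have e : ∑ i ∈ I, (a • z + b • w) i = a * ∑ i ∈ I, z i + b * ∑ i ∈ I, w i := by
    simp [Finset.sum_add_distrib, Finset.mul_sum]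
  rw [e]
  generalize ∑ i ∈ I, z i = p at *
  generalize ∑ i ∈ I, w i = r at *
  have hab' : 0 < a ∨ 0 < b := by
    by_contra hc
    push Not at hc
    linarith
  by_cases hx : 0 < ∑ i ∈ I, x i
  · have hp := z2.2 hx
    have hr := w2.2 hx
    have : 0 < a * p + b * r := by
      rcases hab' with h | h
      · nlinarith [mul_pos h hp, mul_nonneg hb hr.le]
      · nlinarith [mul_pos h hr, mul_nonneg ha hp.le]
    exact ⟨this.ne', by simp [this, hx]⟩
  · have hp : p < 0 := lt_of_le_of_ne (not_lt.1 (fun c => hx (z2.1 c))) z1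
    have hr : r < 0 := lt_of_le_of_ne (not_lt.1 (fun c => hx (w2.1 c))) w1
    have : a * p + b * r < 0 := by
      rcases hab' with h | h
      · nlinarith [mul_pos h (neg_pos.2 hp), mul_nonneg hb (neg_pos.2 hr).le]
      · nlinarith [mul_pos h (neg_pos.2 hr), mul_nonneg ha (neg_pos.2 hp).le]
    exact ⟨this.ne, by simp [this.le, hx]⟩

theorem sg_locConst {n : ℕ} (G : SimpleGraph (Fin n)) :
    IsLocallyConstant (fun z : realCompl G => sg G z.1) := by
  rw [IsLocallyConstant.iff_eventually_eq]
  intro x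
  simp only [sg_eq_iff]
  rw [Filter.eventually_all]
  intro I
  by_cases hI : ConnSet G I
  · have hc : Continuous (fun z : realCompl G => ∑ i ∈ I, z.1 i) := by fun_prop
    rcases lt_or_gt_of_ne (x.2 I hI) with h | h
    · filter_upwards [hc.continuousAt.eventually_lt_const h] with y hy _
      exact ⟨fun h' => absurd h' (by linarith), fun h' => absurd h' (by linarith)⟩
    · filter_upwards [hc.continuousAt.eventually_const_lt h] with y hy _
      exact ⟨fun _ => h, fun _ => hy⟩
  · exact Filter.Eventually.of_forall fun _ h => absurd h hI

theorem card_components {n : ℕ} (G : SimpleGraph (Fin n)) :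
    Nat.card (ConnectedComponents (realCompl G)) = (sg G '' realCompl G).ncard := by
  let _ : TopologicalSpace (Set (Finset (Fin n))) := ⊥
  have : DiscreteTopology (Set (Finset (Fin n))) := ⟨rfl⟩
  have hcont : Continuous (fun z : realCompl G => sg G z.1) := (sg_locConst G).continuous
  have hinj : Function.Injective hcont.connectedComponentsLift := by
    intro a b
    obtain ⟨x, rfl⟩ := ConnectedComponents.surjective_coe a
    obtain ⟨y, rfl⟩ := ConnectedComponents.surjective_coe b
    intro h
    simp only [Continuous.connectedComponentsLift_apply_coe] at h
    rw [ConnectedComponents.coe_eq_coe']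
    have hpre : IsPreconnected {z : realCompl G | sg G z.1 = sg G y.1} := by
      rw [← Topology.IsInducing.subtypeVal.isPreconnected_image]
      have : Subtype.val '' {z : realCompl G | sg G z.1 = sg G y.1} =
          {z | z ∈ realCompl G ∧ sg G z = sg G y.1} := by
        ext z
        simp [and_comm]
      rw [this]
      exact (sg_fiber_convex G y.1).isPreconnected
    exact hpre.subset_connectedComponent (show y ∈ {z : realCompl G | sg G z.1 = sg G y.1} from rfl) h
  have hr : Set.range hcont.connectedComponentsLift = sg G '' realCompl G := by
    ext v
    constructor
    · rintro ⟨a, rfl⟩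
      obtain ⟨x, rfl⟩ := ConnectedComponents.surjective_coe a
      exact ⟨x.1, x.2, rfl⟩
    · rintro ⟨x, hx, rfl⟩
      exact ⟨((⟨x, hx⟩ : realCompl G) : ConnectedComponents (realCompl G)), rfl⟩
  rw [← hr, ← Set.image_univ, Set.ncard_image_of_injective _ hinj, Set.ncard_univ]

/-! ### Connected sets of the cycle -/

theorem cyc_adj_succ {n : ℕ} (_hn : 3 ≤ n) (a b : Fin n) (h : a.val + 1 = b.val) :
    (SimpleGraph.cycleGraph n).Adj a b := by
  rw [SimpleGraph.cycleGraph_adj']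
  right
  rw [Fin.sub_val_of_le (by rw [Fin.le_def]; omega)]
  omega

theorem cyc_adj_wrap {n : ℕ} (_hn : 3 ≤ n) (a b : Fin n) (h : a.val = 0) (h' : b.val + 1 = n) :
    (SimpleGraph.cycleGraph n).Adj a b := by
  rw [SimpleGraph.cycleGraph_adj']
  left
  rw [Fin.coe_sub_iff_lt.2 (by rw [Fin.lt_def]; omega)]
  omega

theorem cyc_adj_cases {n : ℕ} (_hn : 3 ≤ n) (a b : Fin n) (h : (SimpleGraph.cycleGraph n).Adj a b) :
    a.val + 1 = b.val ∨ b.val + 1 = a.val ∨ (a.val = 0 ∧ b.val + 1 = n) ∨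
      (b.val = 0 ∧ a.val + 1 = n) := by
  rw [SimpleGraph.cycleGraph_adj'] at h
  rcases le_or_gt a b with hab | hab
  · rcases eq_or_lt_of_le hab with rfl | hlt
    · have := h.elim id id
      rw [Fin.sub_val_of_le le_rfl] at this
      omega
    · rw [Fin.coe_sub_iff_lt.2 hlt, Fin.sub_val_of_le hab] at h
      rw [Fin.lt_def] at hlt
      omega
  · rw [Fin.coe_sub_iff_lt.2 hab, Fin.sub_val_of_le hab.le] at h
    rw [Fin.lt_def] at hab
    omega

theorem conn_of_root {n : ℕ} (G : SimpleGraph (Fin n)) (I : Finset (Fin n)) (r : Fin n)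
    (hr : r ∈ I) (h : ∀ a (ha : a ∈ I), (G.induce (↑I : Set (Fin n))).Reachable ⟨a, ha⟩ ⟨r, hr⟩) :
    ConnSet G I := by
  refine ⟨⟨r, hr⟩, ?_⟩
  rw [SimpleGraph.connected_iff_exists_forall_reachable]
  exact ⟨⟨r, hr⟩, fun w => (h w.1 w.2).symm⟩

theorem conn_Ico {n : ℕ} (hn : 3 ≤ n) (i j : Fin n) (hij : i < j) :
    ConnSet (SimpleGraph.cycleGraph n) (Finset.Ico i j) := by
  have hi : i ∈ Finset.Ico i j := by simp [hij]
  refine conn_of_root _ _ i hi ?_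
  have key : ∀ k : ℕ, ∀ a : Fin n, ∀ ha : a ∈ Finset.Ico i j, a.val = i.val + k →
      ((SimpleGraph.cycleGraph n).induce (↑(Finset.Ico i j) : Set (Fin n))).Reachable
        ⟨a, ha⟩ ⟨i, hi⟩ := by
    intro k
    induction k with
    | zero =>
      intro a ha h
      have : a = i := Fin.ext (by omega)
      subst this
      exact SimpleGraph.Reachable.refl _
    | succ k ih =>
      intro a ha h
      have ha' := Finset.mem_Ico.1 ha
      have h2 := ha'.2
      rw [Fin.lt_def] at h2
      have hb : (⟨a.val - 1, by omega⟩ : Fin n) ∈ Finset.Ico i j := by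
        rw [Finset.mem_Ico, Fin.le_def, Fin.lt_def]
        simp only
        omega
      refine SimpleGraph.Reachable.trans (SimpleGraph.Adj.reachable ?_)
        (ih ⟨a.val - 1, by omega⟩ hb (by simp only; omega))
      exact (cyc_adj_succ hn _ _ (show (a.val - 1) + 1 = a.val by omega)).symm
  intro a ha
  have ha' := (Finset.mem_Ico.1 ha).1
  rw [Fin.le_def] at ha'
  exact key (a.val - i.val) a ha (by omega)

theorem conn_Ico_compl {n : ℕ} (hn : 3 ≤ n) (i j : Fin n) (hij : i ≤ j) :
    ConnSet (SimpleGraph.cycleGraph n) (Finset.Ico i j)ᶜ := by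
  have mem : ∀ a : Fin n, a ∈ (Finset.Ico i j)ᶜ ↔ a.val < i.val ∨ j.val ≤ a.val := by
    intro a
    rw [Finset.mem_compl, Finset.mem_Ico, Fin.le_def, Fin.lt_def]
    omega
  rw [Fin.le_def] at hij
  have hjn := j.2
  let r : Fin n := ⟨n - 1, by omega⟩
  have hr : r ∈ (Finset.Ico i j)ᶜ := by
    rw [mem]; right; simp only [r]; omega
  refine conn_of_root _ _ r hr ?_
  have up : ∀ k : ℕ, ∀ a : Fin n, ∀ ha : a ∈ (Finset.Ico i j)ᶜ, j.val ≤ a.val → a.val + k + 1 = n →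
      ((SimpleGraph.cycleGraph n).induce (↑((Finset.Ico i j)ᶜ) : Set (Fin n))).Reachable
        ⟨a, ha⟩ ⟨r, hr⟩ := by
    intro k
    induction k with
    | zero =>
      intro a ha _ h
      have : a = r := Fin.ext (by simp only [r]; omega)
      subst this
      exact SimpleGraph.Reachable.refl _
    | succ k ih =>
      intro a ha h1 h
      have hb : (⟨a.val + 1, by omega⟩ : Fin n) ∈ (Finset.Ico i j)ᶜ := by
        rw [mem]; simp only; omega
      refine SimpleGraph.Reachable.trans (SimpleGraph.Adj.reachable ?_)
        (ih ⟨a.val + 1, by omega⟩ hb (by simp only; omega) (by simp only; omega))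
      exact (cyc_adj_succ hn _ _ rfl)
  have down : ∀ k : ℕ, ∀ a : Fin n, ∀ ha : a ∈ (Finset.Ico i j)ᶜ, a.val < i.val → a.val = k →
      ((SimpleGraph.cycleGraph n).induce (↑((Finset.Ico i j)ᶜ) : Set (Fin n))).Reachable
        ⟨a, ha⟩ ⟨r, hr⟩ := by
    intro k
    induction k with
    | zero =>
      intro a ha _ h
      refine SimpleGraph.Adj.reachable ?_
      exact cyc_adj_wrap hn a r h (by simp only [r]; omega)
    | succ k ih =>
      intro a ha h1 h
      have hb : (⟨a.val - 1, by omega⟩ : Fin n) ∈ (Finset.Ico i j)ᶜ := by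
        rw [mem]; simp only; omega
      refine SimpleGraph.Reachable.trans (SimpleGraph.Adj.reachable ?_)
        (ih ⟨a.val - 1, by omega⟩ hb (by simp only; omega) (by simp only; omega))
      exact (cyc_adj_succ hn _ _ (show (a.val - 1) + 1 = a.val by omega)).symm
  intro a ha
  rcases (mem a).1 ha with h | h
  · exact down a.val a ha h rfl
  · exact up (n - 1 - a.val) a ha h (by omega)

theorem conn_between {n : ℕ} (hn : 3 ≤ n) (I : Finset (Fin n))
    (hI : ConnSet (SimpleGraph.cycleGraph n) I) (p r k : Fin n) (hp : p ∉ I) (hr : r ∉ I)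
    (hk : k ∈ I) (hpk : p < k) (hkr : k < r) (a : Fin n) (ha : a ∈ I) : p < a ∧ a < r := by
  have hreach := hI.2.preconnected ⟨k, hk⟩ ⟨a, ha⟩
  have key : ∀ u v : (↑I : Set (Fin n)),
      ((SimpleGraph.cycleGraph n).induce (↑I : Set (Fin n))).Walk u v →
      (p < u.1 ∧ u.1 < r) → (p < v.1 ∧ v.1 < r) := by
    intro u v w
    induction w with
    | nil => exact id
    | @cons u v w hadj _ ih =>
      intro hu
      apply ih
      have hadj' : (SimpleGraph.cycleGraph n).Adj u.1 v.1 := hadj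
      have hvp : v.1 ≠ p := fun h => hp (h ▸ v.2)
      have hvr : v.1 ≠ r := fun h => hr (h ▸ v.2)
      have := cyc_adj_cases hn _ _ hadj'
      have := r.2
      rw [Fin.lt_def, Fin.lt_def] at *
      rw [Ne, Fin.ext_iff] at hvp hvr
      omega
  obtain ⟨w⟩ := hreach
  exact key _ _ w ⟨hpk, hkr⟩

theorem conn_cases {n : ℕ} (hn : 3 ≤ n) (I : Finset (Fin n))
    (hI : ConnSet (SimpleGraph.cycleGraph n) I) :
    I = univ ∨ ∃ i j : Fin n, i < j ∧ (I = Finset.Ico i j ∨ I = (Finset.Ico i j)ᶜ) := by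
  let l : Fin n := ⟨n - 1, by omega⟩
  have hle : ∀ a : Fin n, a ≤ l := by
    intro a; rw [Fin.le_def]; simp only [l]; omega
  by_cases hl : l ∈ I
  · by_cases hu : I = univ
    · exact Or.inl hu
    right
    have hne : (Iᶜ).Nonempty := by
      rw [Finset.nonempty_iff_ne_empty]
      simpa using hu
    set p := (Iᶜ).min' hne with hpdef
    set r := (Iᶜ).max' hne with hrdef
    have hp : p ∉ I := by simpa using (Iᶜ).min'_mem hne
    have hr : r ∉ I := by simpa using (Iᶜ).max'_mem hne
    have hrl : r.val + 1 < n := by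
      have h1 : r ≠ l := fun h => hr (h ▸ hl)
      have h2 := hle r
      rw [Ne, Fin.ext_iff] at h1
      rw [Fin.le_def] at h2
      simp only [l] at h1 h2
      omega
    have hpr : p ≤ r := (Iᶜ).min'_le r (by simpa using hr)
    refine ⟨p, ⟨r.val + 1, hrl⟩, ?_, Or.inr ?_⟩
    · rw [Fin.lt_def]; rw [Fin.le_def] at hpr; simp only; omega
    · rw [eq_compl_comm]
      ext k
      rw [Finset.mem_Ico]
      have hk2 : (k < (⟨r.val + 1, hrl⟩ : Fin n)) ↔ k ≤ r := by
        rw [Fin.lt_def, Fin.le_def]; simp only; omega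
      rw [hk2]
      constructor
      · rintro ⟨h1, h2⟩
        rw [Finset.mem_compl]
        intro hk
        have h1' : p < k := lt_of_le_of_ne h1 (fun h => hp (h ▸ hk))
        have h2' : k < r := lt_of_le_of_ne h2 (fun h => hr (h ▸ hk))
        have := (conn_between hn I hI p r k hp hr hk h1' h2' l hl).2
        exact absurd this (not_lt.2 (hle r))
      · intro hk
        exact ⟨(Iᶜ).min'_le k hk, (Iᶜ).le_max' k hk⟩
  · right
    have hne := hI.1
    set p := I.min' hne with hpdef
    set r := I.max' hne with hrdef
    have hp : p ∈ I := I.min'_mem hne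
    have hr : r ∈ I := I.max'_mem hne
    have hrl : r.val + 1 < n := by
      have h1 : r ≠ l := fun h => hl (h ▸ hr)
      have h2 := hle r
      rw [Ne, Fin.ext_iff] at h1
      rw [Fin.le_def] at h2
      simp only [l] at h1 h2
      omega
    have hpr : p ≤ r := I.min'_le r hr
    refine ⟨p, ⟨r.val + 1, hrl⟩, ?_, Or.inl ?_⟩
    · rw [Fin.lt_def]; rw [Fin.le_def] at hpr; simp only; omega
    · ext k
      rw [Finset.mem_Ico]
      have hk2 : (k < (⟨r.val + 1, hrl⟩ : Fin n)) ↔ k ≤ r := by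
        rw [Fin.lt_def, Fin.le_def]; simp only; omega
      rw [hk2]
      constructor
      · intro hk
        exact ⟨I.min'_le k hk, I.le_max' k hk⟩
      · rintro ⟨h1, h2⟩
        by_contra hk
        have h1' : p < k := lt_of_le_of_ne h1 (fun h => hk (h ▸ hp))
        have h2' : k < r := lt_of_le_of_ne h2 (fun h => hk (h ▸ hr))
        have hrl' : r < l := by rw [Fin.lt_def]; simp only [l]; omega
        have := (conn_between hn I hI k l r hk hl hr h2' hrl' p hp).1
        exact absurd this (not_lt.2 h1)

/-! ### Comparison with the Shi arrangement -/

/-- partial sums -/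
def ps {n : ℕ} (x : Fin n → ℝ) (k : Fin n) : ℝ := ∑ a ∈ Finset.Iio k, x a

theorem ps_Ico {n : ℕ} (x : Fin n → ℝ) (i j : Fin n) (h : i ≤ j) :
    ∑ a ∈ Finset.Ico i j, x a = ps x j - ps x i := by
  have hd : Disjoint (Finset.Iio i) (Finset.Ico i j) := by
    rw [Finset.disjoint_left]
    intro a
    simp only [Finset.mem_Iio, Finset.mem_Ico]
    exact fun h1 h2 => absurd h1 (not_lt.2 h2.1)
  have hu : Finset.Iio j = (Finset.Iio i) ∪ (Finset.Ico i j) := by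
    ext a
    simp only [Finset.mem_Iio, Finset.mem_Ico, Finset.mem_union]
    rw [Fin.lt_def, Fin.lt_def, Fin.le_def]
    rw [Fin.le_def] at h
    omega
  unfold ps
  rw [hu, Finset.sum_union hd]
  ring

theorem ps_Ico_compl {n : ℕ} (x : Fin n → ℝ) (i j : Fin n) (h : i ≤ j) :
    ∑ a ∈ (Finset.Ico i j)ᶜ, x a = ∑ a, x a - (ps x j - ps x i) := by
  rw [← ps_Ico x i j h, ← Finset.sum_add_sum_compl (Finset.Ico i j)]
  ring

theorem conn_univ {n : ℕ} (hn : 3 ≤ n) : ConnSet (SimpleGraph.cycleGraph n) univ := by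
  have := conn_Ico_compl hn ⟨0, by omega⟩ ⟨0, by omega⟩ le_rfl
  simpa using this

theorem mem_realCompl {n : ℕ} (hn : 3 ≤ n) (x : Fin n → ℝ) :
    x ∈ realCompl (SimpleGraph.cycleGraph n) ↔ ∑ a, x a ≠ 0 ∧ ∀ i j : Fin n, i < j →
      ps x j - ps x i ≠ 0 ∧ ∑ a, x a - (ps x j - ps x i) ≠ 0 := by
  constructor
  · intro h
    refine ⟨h _ (conn_univ hn), fun i j hij => ⟨?_, ?_⟩⟩
    · rw [← ps_Ico x i j hij.le]; exact h _ (conn_Ico hn i j hij)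
    · rw [← ps_Ico_compl x i j hij.le]; exact h _ (conn_Ico_compl hn i j hij.le)
  · rintro ⟨h0, h⟩ I hI
    rcases conn_cases hn I hI with rfl | ⟨i, j, hij, rfl | rfl⟩
    · exact h0
    · rw [ps_Ico x i j hij.le]; exact (h i j hij).1
    · rw [ps_Ico_compl x i j hij.le]; exact (h i j hij).2

theorem sg_cyc {n : ℕ} (hn : 3 ≤ n) (x y : Fin n → ℝ) :
    sg (SimpleGraph.cycleGraph n) x = sg (SimpleGraph.cycleGraph n) y ↔
      (0 < ∑ a, x a ↔ 0 < ∑ a, y a) ∧ ∀ i j : Fin n, i < j →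
      (0 < ps x j - ps x i ↔ 0 < ps y j - ps y i) ∧
      (0 < ∑ a, x a - (ps x j - ps x i) ↔ 0 < ∑ a, y a - (ps y j - ps y i)) := by
  rw [sg_eq_iff]
  constructor
  · intro h
    refine ⟨h _ (conn_univ hn), fun i j hij => ⟨?_, ?_⟩⟩
    · rw [← ps_Ico x i j hij.le, ← ps_Ico y i j hij.le]; exact h _ (conn_Ico hn i j hij)
    · rw [← ps_Ico_compl x i j hij.le, ← ps_Ico_compl y i j hij.le]
      exact h _ (conn_Ico_compl hn i j hij.le)
  · rintro ⟨h0, h⟩ I hI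
    rcases conn_cases hn I hI with rfl | ⟨i, j, hij, rfl | rfl⟩
    · exact h0
    · rw [ps_Ico x i j hij.le, ps_Ico y i j hij.le]; exact (h i j hij).1
    · rw [ps_Ico_compl x i j hij.le, ps_Ico_compl y i j hij.le]; exact (h i j hij).2

theorem lift_exists {n : ℕ} (hn : 3 ≤ n) (y : Fin n → ℝ) :
    ∃ x : Fin n → ℝ, ∑ a, x a = 1 ∧ ∀ i j : Fin n, ps x j - ps x i = y j - y i := by
  let z : Fin n := ⟨0, by omega⟩
  let x : Fin n → ℝ := fun a => if h : a.val + 1 < n then y ⟨a.val + 1, h⟩ - y a else 1 - y a + y z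
  have hps : ∀ k : ℕ, ∀ hk : k < n, ps x ⟨k, hk⟩ = y ⟨k, hk⟩ - y z := by
    intro k
    induction k with
    | zero =>
      intro hk
      have : Finset.Iio (⟨0, hk⟩ : Fin n) = ∅ := by
        ext a
        simp [Fin.lt_def]
      simp [ps, this, z]
    | succ k ih =>
      intro hk
      have e := ps_Ico x ⟨k, by omega⟩ ⟨k + 1, hk⟩ (by rw [Fin.le_def]; simp)
      have : Finset.Ico (⟨k, by omega⟩ : Fin n) ⟨k + 1, hk⟩ = {⟨k, by omega⟩} := by
        ext a
        rw [Finset.mem_Ico, Fin.le_def, Fin.lt_def, Finset.mem_singleton, Fin.ext_iff]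
        simp only
        omega
      rw [this, Finset.sum_singleton, ih (by omega)] at e
      simp only [x, hk, dite_true] at e
      linarith
  refine ⟨x, ?_, fun i j => by
    rw [show ps x j = _ from hps j.1 j.2, show ps x i = _ from hps i.1 i.2]; simp⟩
  have e := hps (n - 1) (by omega)
  have : (univ : Finset (Fin n)) = insert (⟨n - 1, by omega⟩ : Fin n)
      (Finset.Iio (⟨n - 1, by omega⟩ : Fin n)) := by
    ext a
    have := a.2
    simp only [mem_univ, mem_insert, Finset.mem_Iio, Fin.lt_def, Fin.ext_iff, true_iff]
    omega
  rw [this, Finset.sum_insert (by simp)]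
  unfold ps at e
  rw [e]
  have hx : x ⟨n - 1, by omega⟩ = 1 - y ⟨n - 1, by omega⟩ + y z := by
    simp only [x]
    rw [dif_neg (by omega)]
  rw [hx]
  ring

theorem card_pos {n : ℕ} (hn : 3 ≤ n) :
    (sg (SimpleGraph.cycleGraph n) ''
      {x | x ∈ realCompl (SimpleGraph.cycleGraph n) ∧ 0 < ∑ a, x a}).ncard = reg (shi n) := by
  have ev0 : ∀ (x : Fin n → ℝ) (i j : Fin n), ev (j, i, 0) x = x j - x i := by
    intro x i j; simp [ev]
  have ev1 : ∀ (x : Fin n → ℝ) (i j : Fin n), ev (j, i, 1) x = x j - x i - 1 := by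
    intro x i j; simp [ev]
  have q0 : ∀ (x : Fin n → ℝ) (i j : Fin n), ps x j / (∑ a, x a) - ps x i / (∑ a, x a) =
      (ps x j - ps x i) / (∑ a, x a) := by
    intro x i j; rw [sub_div]
  have q1 : ∀ (x : Fin n → ℝ) (i j : Fin n), 0 < ∑ a, x a → (ps x j - ps x i) / (∑ a, x a) - 1 =
      (- (∑ a, x a - (ps x j - ps x i))) / (∑ a, x a) := by
    intro x i j h; field_simp; ring
  unfold reg
  refine ncard_image_eq _ _ _ _ (fun x k => ps x k / ∑ a, x a) ?_ ?_ ?_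
  · rintro x ⟨hx, hT⟩
    rw [mem_realCompl hn] at hx
    simp only [cpl, Set.mem_ofPred_eq]
    rw [forall_shi]
    intro i j hij
    have := hx.2 i j hij
    rw [ev0, ev1, q0, q1 _ _ _ hT]
    exact ⟨div_ne_zero this.1 hT.ne', div_ne_zero (neg_ne_zero.2 this.2) hT.ne'⟩
  · rintro x ⟨hx, hT⟩ x' ⟨hx', hT'⟩
    rw [mem_realCompl hn] at hx hx'
    rw [sg_cyc hn, sig_eq_iff, forall_shi]
    simp only [hT, hT', true_and]
    refine forall_congr' fun i => forall_congr' fun j => forall_congr' fun hij => ?_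
    have a := (hx.2 i j hij).2
    have b := (hx'.2 i j hij).2
    rw [ev0, ev1, ev0, ev1, q0, q1 _ _ _ hT, q0, q1 _ _ _ hT']
    simp only [div_pos_iff_of_pos_right hT, div_pos_iff_of_pos_right hT', neg_pos]
    have e : ∀ u : ℝ, u ≠ 0 → (u < 0 ↔ ¬ 0 < u) := fun u hu =>
      ⟨fun h => not_lt.2 h.le, fun h => lt_of_le_of_ne (not_lt.1 h) hu⟩
    rw [e _ a, e _ b, not_iff_not]
  · intro y hy
    obtain ⟨x, hx1, hx2⟩ := lift_exists hn y
    simp only [cpl, Set.mem_ofPred_eq] at hy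
    rw [forall_shi] at hy
    refine ⟨x, ⟨(mem_realCompl hn x).2 ⟨by rw [hx1]; simp, fun i j hij => ?_⟩,
      by rw [hx1]; simp⟩, ?_⟩
    · have := hy i j hij
      rw [ev0, ev1] at this
      rw [hx2, hx1]
      exact ⟨this.1, fun h => this.2 (by linarith)⟩
    · rw [sig_eq_iff, forall_shi]
      intro i j hij
      simp only [ev0, ev1, hx1, div_one, hx2]
      simp

theorem card_neg {n : ℕ} (hn : 3 ≤ n) :
    (sg (SimpleGraph.cycleGraph n) ''
      {x | x ∈ realCompl (SimpleGraph.cycleGraph n) ∧ ∑ a, x a < 0}).ncard = reg (shi n) := by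
  rw [← card_pos hn]
  have hneg : ∀ x ∈ realCompl (SimpleGraph.cycleGraph n),
      -x ∈ realCompl (SimpleGraph.cycleGraph n) := by
    intro x hx I hI
    simpa using hx I hI
  refine ncard_image_eq _ _ _ _ (fun x => -x) ?_ ?_ ?_
  · rintro x ⟨hx, hT⟩
    exact ⟨hneg x hx, by simpa using hT⟩
  · rintro x ⟨hx, hT⟩ y ⟨hy, hT'⟩
    rw [sg_eq_iff, sg_eq_iff]
    refine forall_congr' fun I => forall_congr' fun hI => ?_
    have a := hx I hI
    have b := hy I hI
    simp only [Pi.neg_apply, Finset.sum_neg_distrib, neg_pos]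
    have e : ∀ u : ℝ, u ≠ 0 → (u < 0 ↔ ¬ 0 < u) := fun u hu =>
      ⟨fun h => not_lt.2 h.le, fun h => lt_of_le_of_ne (not_lt.1 h) hu⟩
    rw [e _ a, e _ b, not_iff_not]
  · rintro y ⟨hy, hT⟩
    refine ⟨-y, ⟨hneg y hy, by simpa using hT⟩, by simp⟩

end CsaAux

/-- For `n ≥ 3`, the complement in `ℝ^n` of the union of the
hyperplanes of the connected subgraph arrangement of the cycle graph `C_n` has exactly
`2(n+1)^{n−1}` connected components (chambers). -/
theorem csa_cycle_chambers (n : ℕ) (hn : 3 ≤ n) :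
    Nat.card (ConnectedComponents (realCompl (SimpleGraph.cycleGraph n))) =
      2 * (n + 1) ^ (n - 1) := by
  open CsaAux in
  rw [card_components]
  have hsplit : sg (SimpleGraph.cycleGraph n) '' realCompl (SimpleGraph.cycleGraph n) =
      (sg (SimpleGraph.cycleGraph n) ''
        {x | x ∈ realCompl (SimpleGraph.cycleGraph n) ∧ 0 < ∑ a, x a}) ∪
      (sg (SimpleGraph.cycleGraph n) ''
        {x | x ∈ realCompl (SimpleGraph.cycleGraph n) ∧ ∑ a, x a < 0}) := by
    rw [← Set.image_union]
    congr 1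
    ext x
    constructor
    · intro hx
      rcases lt_or_gt_of_ne (hx univ (conn_univ hn)) with h | h
      · exact Or.inr ⟨hx, h⟩
      · exact Or.inl ⟨hx, h⟩
    · rintro (h | h) <;> exact h.1
  rw [hsplit, Set.ncard_union_eq _ (Set.toFinite _) (Set.toFinite _), card_pos hn, card_neg hn,
    reg_shi n (by omega)]
  · ring
  · rw [Set.disjoint_left]
    rintro _ ⟨x, ⟨_, hx⟩, rfl⟩ ⟨y, ⟨_, hy⟩, hxy⟩
    have := ((sg_cyc hn y x).1 hxy).1.2 hx
    linarith
end

section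
/- Let 1 < k < n and let A_{n,k} be the almost path graph on vertices [n+1]. Then the connected subgraph arrangement 𝒜_{A_{n,k}} over ℚ is free, i.e. its module of 𝒜_{A_{n,k}}-derivations is a free module over ℚ[x_1,…,x_{n+1}]. -/
open Finset

open MvPolynomial in
lemma linS_coeff {N : ℕ} (I : Finset (Fin N)) (j : Fin N) :
    (∑ i ∈ I, (X i : MvPolynomial (Fin N) ℚ)).coeff (Finsupp.single j 1) = if j ∈ I then 1 else 0 := by
  classical
  rw [coeff_sum]
  simp only [coeff_X, Finsupp.single_left_inj one_ne_zero]
  simp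

open MvPolynomial in
lemma linS_degree {N : ℕ} (I : Finset (Fin N)) (hI : I.Nonempty) :
    (∑ i ∈ I, (X i : MvPolynomial (Fin N) ℚ)).totalDegree = 1 := by
  apply le_antisymm
  · apply totalDegree_finsetSum_le
    intro i _
    simp
  · obtain ⟨j, hj⟩ := hI
    have := le_totalDegree (p := ∑ i ∈ I, (X i : MvPolynomial (Fin N) ℚ)) (s := Finsupp.single j 1)
      (by rw [mem_support_iff, linS_coeff]; simp [hj])
    simpa using this

open MvPolynomial in
lemma linS_irred {N : ℕ} (I : Finset (Fin N)) (hI : I.Nonempty) :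
    Irreducible (∑ i ∈ I, (X i : MvPolynomial (Fin N) ℚ)) := by
  apply irreducible_of_totalDegree_eq_one (linS_degree I hI)
  intro x hx
  obtain ⟨j, hj⟩ := hI
  have := hx (Finsupp.single j 1)
  rw [linS_coeff] at this
  simp [hj] at this
  exact isUnit_iff_ne_zero.2 this

open MvPolynomial in
lemma linS_relPrime {N : ℕ} (I J : Finset (Fin N)) (hI : I.Nonempty) (hJ : J.Nonempty) (hIJ : I ≠ J) :
    IsRelPrime (∑ i ∈ I, (X i : MvPolynomial (Fin N) ℚ)) (∑ i ∈ J, (X i : MvPolynomial (Fin N) ℚ)) := by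
  classical
  rw [(linS_irred I hI).isRelPrime_iff_not_dvd]
  rintro ⟨c, hc⟩
  have h1 := linS_degree J hJ
  have hc0 : c ≠ 0 := by
    rintro rfl
    rw [hc] at h1
    simp at h1
  rw [hc, totalDegree_mul_of_isDomain (linS_irred I hI).ne_zero hc0, linS_degree I hI] at h1
  have h2 : c.totalDegree = 0 := by omega
  rw [totalDegree_eq_zero_iff_eq_C] at h2
  rw [h2, mul_comm] at hc
  have key : ∀ j, (if j ∈ J then (1:ℚ) else 0) = coeff 0 c * (if j ∈ I then 1 else 0) := by
    intro j
    rw [← linS_coeff, ← linS_coeff, hc, coeff_C_mul]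
  have hne : coeff 0 c ≠ 0 := fun h => hc0 (by rw [h2, h]; simp)
  apply hIJ
  ext j
  have := key j
  by_cases h3 : j ∈ I <;> by_cases h4 : j ∈ J
  · simp [h3, h4]
  · rw [if_pos h3, if_neg h4, mul_one] at this
    exact absurd this.symm hne
  · rw [if_neg h3, if_pos h4, mul_zero] at this
    exact absurd this one_ne_zero
  · simp [h3, h4]

open MvPolynomial in
lemma form_dvd_det {N : ℕ} {G : SimpleGraph (Fin N)}
    (M : Matrix (Fin N) (Fin N) (MvPolynomial (Fin N) ℚ))
    (hM : ∀ l, mkDerivation ℚ (M l) ∈ derModule G) (I : Finset (Fin N)) (hI : ConnSet G I) :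
    (∑ i ∈ I, (X i : MvPolynomial (Fin N) ℚ)) ∣ M.det := by
  classical
  have h : ∀ l, ∃ w, ∑ i ∈ I, M l i = (∑ i ∈ I, (X i : MvPolynomial (Fin N) ℚ)) * w := by
    intro l
    have := hM l I hI
    rw [map_sum] at this
    simp only [mkDerivation_X] at this
    exact this
  choose w hw using h
  obtain ⟨j, hj⟩ := hI.1
  set a : Fin N → MvPolynomial (Fin N) ℚ := fun i => if i ∈ I then 1 else 0 with ha
  have h1 : M.mulVec a = (∑ i ∈ I, (X i : MvPolynomial (Fin N) ℚ)) • w := by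
    ext1 l
    simp only [Matrix.mulVec, dotProduct, ha, Pi.smul_apply, smul_eq_mul, ← hw]
    simp
  have h2 : M.det • a = (∑ i ∈ I, (X i : MvPolynomial (Fin N) ℚ)) • (M.adjugate.mulVec w) := by
    rw [← Matrix.mulVec_smul, ← h1, Matrix.mulVec_mulVec, Matrix.adjugate_mul, Matrix.smul_mulVec,
      Matrix.one_mulVec]
  have h3 := congrFun h2 j
  simp only [Pi.smul_apply, smul_eq_mul, ha, hj, if_true, mul_one] at h3
  exact ⟨_, h3⟩

lemma free_of_coord {N : ℕ} {R V : Type*} [CommRing R] [IsDomain R] [AddCommGroup V] [Module R V]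
    (D : Submodule R V) (φ : V →ₗ[R] (Fin N → R)) (hφ : Function.Injective φ)
    (v : Fin N → V) (hv : ∀ l, v l ∈ D)
    (hdet : (Matrix.of fun l => φ (v l)).det ≠ 0)
    (hdvd : ∀ θ ∈ D, ∀ l, (Matrix.of fun l => φ (v l)).det ∣
      ((Matrix.of fun l => φ (v l)).updateRow l (φ θ)).det) : Module.Free R D := by
  classical
  set M : Matrix (Fin N) (Fin N) R := Matrix.of fun l => φ (v l) with hM
  let w : Fin N → D := fun l => ⟨v l, hv l⟩
  have hsumapp : ∀ (g : Fin N → R) (i : Fin N),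
      φ ((∑ l, g l • w l : D) : V) i = ∑ l, g l * M l i := by
    intro g i
    simp [w, hM]
  have hli : LinearIndependent R w := by
    rw [Fintype.linearIndependent_iff]
    intro g hg
    by_contra! hcon
    obtain ⟨i, hi⟩ := hcon
    apply hdet
    apply Matrix.exists_vecMul_eq_zero_iff.1
    refine ⟨g, fun h => hi (by rw [h]; rfl), ?_⟩
    ext1 j
    have := hsumapp g j
    rw [hg] at this
    simpa [Matrix.vecMul, dotProduct] using this.symm
  have hspan : ⊤ ≤ Submodule.span R (Set.range w) := by
    rintro ⟨θ, hθ⟩ -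
    choose e he using hdvd θ hθ
    have h2 : (⟨θ, hθ⟩ : D) = ∑ l, e l • w l := by
      apply Subtype.ext
      apply hφ
      ext1 i
      rw [hsumapp]
      apply mul_left_cancel₀ hdet
      have h3 := congrFun (Matrix.mulVec_cramer M.transpose (φ θ)) i
      rw [Matrix.det_transpose] at h3
      simp only [Pi.smul_apply, smul_eq_mul] at h3
      rw [← h3, Finset.mul_sum]
      simp only [Matrix.mulVec, dotProduct]
      apply Finset.sum_congr rfl
      intro l _
      rw [Matrix.cramer_transpose_apply, he, Matrix.transpose_apply]
      ring
    rw [h2]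
    exact Submodule.sum_mem _ (fun l _ => Submodule.smul_mem _ _ (Submodule.subset_span ⟨l, rfl⟩))
  exact Module.Free.of_basis (Module.Basis.mk hli hspan)

open MvPolynomial in
lemma saito {N : ℕ} {G : SimpleGraph (Fin N)} {κ : Type} (J : Finset κ) (I : κ → Finset (Fin N))
    (hI : ∀ s ∈ J, ConnSet G (I s)) (hinj : ∀ s ∈ J, ∀ t ∈ J, I s = I t → s = t)
    (M : Matrix (Fin N) (Fin N) (MvPolynomial (Fin N) ℚ))
    (hM : ∀ l, mkDerivation ℚ (M l) ∈ derModule G) (hdet : M.det ≠ 0)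
    (d : Fin N → ℕ) (hd : ∀ l i, (M l i).totalDegree ≤ d l) (hcard : ∑ l, d l ≤ J.card) :
    Module.Free (MvPolynomial (Fin N) ℚ) (derModule G) := by
  classical
  set Q : MvPolynomial (Fin N) ℚ := ∏ s ∈ J, ∑ i ∈ I s, X i with hQ
  have hQdvd : ∀ M' : Matrix (Fin N) (Fin N) (MvPolynomial (Fin N) ℚ),
      (∀ l, mkDerivation ℚ (M' l) ∈ derModule G) → Q ∣ M'.det := by
    intro M' hM'
    apply Finset.prod_dvd_of_isRelPrime
    · intro s hs t ht hst
      exact linS_relPrime _ _ (hI s hs).1 (hI t ht).1 (fun h => hst (hinj s hs t ht h))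
    · intro s hs
      exact form_dvd_det M' hM' _ (hI s hs)
  have hQ0 : Q ≠ 0 := by
    rw [hQ, Finset.prod_ne_zero_iff]
    intro s hs
    exact (linS_irred _ (hI s hs).1).ne_zero
  have hQdeg : Q.totalDegree = J.card := by
    have hg : ∀ J' ⊆ J, (∏ s ∈ J', ∑ i ∈ I s, (X i : MvPolynomial (Fin N) ℚ)).totalDegree
        = J'.card := by
      intro J'
      induction J' using Finset.induction_on with
      | empty => intro _; simp
      | insert s J' hs ih =>
        intro hJ'
        have hsJ : s ∈ J := hJ' (Finset.mem_insert_self _ _)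
        have hsub : J' ⊆ J := (Finset.subset_insert _ _).trans hJ'
        rw [Finset.prod_insert hs, totalDegree_mul_of_isDomain, ih hsub,
          linS_degree _ (hI s hsJ).1, Finset.card_insert_of_notMem hs, add_comm]
        · exact (linS_irred _ (hI s hsJ).1).ne_zero
        · rw [Finset.prod_ne_zero_iff]
          intro t ht
          exact (linS_irred _ (hI t (hsub ht)).1).ne_zero
    exact hg J (Finset.Subset.refl _)
  have hdetdeg : M.det.totalDegree ≤ ∑ l, d l := by
    rw [← Matrix.det_transpose, Matrix.det_apply]
    apply totalDegree_finsetSum_le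
    intro σ _
    refine (totalDegree_smul_le _ _).trans ?_
    refine (totalDegree_finsetProd _ _).trans ?_
    exact Finset.sum_le_sum (fun l _ => hd l _)
  obtain ⟨c, hc⟩ := hQdvd M hM
  have hc0 : c ≠ 0 := by
    rintro rfl
    exact hdet (by simpa using hc)
  have hcC : c.totalDegree = 0 := by
    have := totalDegree_mul_of_isDomain hQ0 hc0
    rw [← hc] at this
    omega
  rw [totalDegree_eq_zero_iff_eq_C] at hcC
  have hr : coeff 0 c ≠ 0 := fun h => hc0 (by rw [hcC, h]; simp)
  have hdetdvd : ∀ M' : Matrix (Fin N) (Fin N) (MvPolynomial (Fin N) ℚ),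
      (∀ l, mkDerivation ℚ (M' l) ∈ derModule G) → M.det ∣ M'.det := by
    intro M' hM'
    obtain ⟨e, he⟩ := hQdvd M' hM'
    refine ⟨C (coeff 0 c)⁻¹ * e, ?_⟩
    have hcc : c * C (coeff 0 c)⁻¹ = 1 := by
      calc c * C (coeff 0 c)⁻¹ = C (coeff 0 c) * C (coeff 0 c)⁻¹ := by rw [← hcC]
        _ = 1 := by rw [← C_mul, mul_inv_cancel₀ hr, C_1]
    rw [he, hc, mul_assoc, ← mul_assoc c, hcc, one_mul]
  let φ : Derivation ℚ (MvPolynomial (Fin N) ℚ) (MvPolynomial (Fin N) ℚ)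
      →ₗ[MvPolynomial (Fin N) ℚ] (Fin N → MvPolynomial (Fin N) ℚ) :=
    { toFun := fun θ i => θ (X i)
      map_add' := fun _ _ => rfl
      map_smul' := fun _ _ => rfl }
  have hφ : Function.Injective φ := by
    intro θ θ' h
    apply derivation_ext
    intro i
    exact congrFun h i
  have hφv : (Matrix.of fun l => φ (mkDerivation ℚ (M l))) = M := by
    ext1 l i
    exact mkDerivation_X _ _ _
  apply free_of_coord (derModule G) φ hφ (fun l => mkDerivation ℚ (M l)) hM
  · rw [hφv]; exact hdet
  · intro θ hθ l
    rw [hφv]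
    apply hdetdvd
    intro m
    by_cases hml : m = l
    · subst hml
      rw [Matrix.updateRow_self]
      convert hθ
      apply derivation_ext
      intro i
      exact mkDerivation_X _ _ _
    · rw [Matrix.updateRow_ne hml]
      exact hM m

set_option maxHeartbeats 1000000 in
open Polynomial in
lemma indep_aux {R : Type*} [CommRing R] [IsDomain R] [CharZero R] (z : R) (hz : z ≠ 0)
    (n k : ℕ) (h1 : 1 < k) (h2 : k < n) (Y : ℕ → R)
    (hY : ∀ i ≤ n, ∀ j ≤ n, Y i = Y j → i = j)
    (hYz : ∀ i < k, ∀ j, k ≤ j → j ≤ n → Y i - z ≠ Y j)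
    (A B : R[X]) (hA : A = ∏ i ∈ range k, (X - C (Y i)))
    (hB : B = ∏ i ∈ Ico k (n+1), (X - C (Y i)))
    (H : ℕ → R[X]) (hH : ∀ l < n, (H l).natDegree ≤ n + 1)
    (hHA : ∀ l < n + 1 - k, (H l).comp (X + C z) - H l = C z * (X ^ l * A.comp (X + C z)))
    (hHB : ∀ l, n + 1 - k ≤ l → l < n → (H l).comp (X + C z) - H l = C z * (X ^ (l - (n+1-k)) * B))
    (v : ℕ → R)
    (hv : ∀ i < n, ∑ l ∈ range n, v l * ((H l).eval (Y (i+1)) - (H l).eval (Y i)) = 0) :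
    ∀ l < n, v l = 0 := by
  classical
  set q := n + 1 - k with hq
  have hAm : A.Monic := by rw [hA]; exact monic_prod_of_monic _ _ (fun i _ => monic_X_sub_C _)
  have hBm : B.Monic := by rw [hB]; exact monic_prod_of_monic _ _ (fun i _ => monic_X_sub_C _)
  have hAd : A.natDegree = k := by
    rw [hA, natDegree_prod_of_monic _ _ (fun i _ => monic_X_sub_C _)]; simp
  have hBd : B.natDegree = q := by
    rw [hB, natDegree_prod_of_monic _ _ (fun i _ => monic_X_sub_C _)]; simp [hq]
  set T0 : R[X] := ∑ l ∈ range n, C (v l) * H l with hT0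
  set T : R[X] := T0 - C (T0.eval (Y 0)) with hT
  have hTY : ∀ i ≤ n, T.eval (Y i) = 0 := by
    intro i
    induction i with
    | zero => intro _; simp [hT]
    | succ i ih =>
      intro hi
      have e1 := ih (by omega)
      have e2 := hv i (by omega)
      have e3 : T.eval (Y (i+1)) - T.eval (Y i) = 0 := by
        rw [← e2, hT, hT0]
        simp [eval_finsetSum, mul_sub]
      rw [e1, sub_zero] at e3
      exact e3
  have hTd : T.natDegree ≤ n + 1 := by
    rw [hT, natDegree_sub_C, hT0]
    apply natDegree_sum_le_of_forall_le
    intro l hl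
    exact (natDegree_C_mul_le _ _).trans (hH l (by simpa using hl))
  have hAB : A * B = ∏ i ∈ range (n+1), (X - C (Y i)) := by
    rw [hA, hB, Finset.prod_range_mul_prod_Ico _ (by omega)]
  have hdvd : A * B ∣ T := by
    rw [hAB]
    have := (Multiset.prod_X_sub_C_dvd_iff_le_roots (p := T)
      (s := (range (n+1)).val.map Y))
    by_cases hT0 : T = 0
    · rw [hT0]; exact dvd_zero _
    have h3 := (this hT0).2 (by
      rw [Multiset.le_iff_subset]
      · intro x hx
        simp only [Multiset.mem_map, Finset.mem_val, Finset.mem_range] at hx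
        obtain ⟨i, hi, rfl⟩ := hx
        rw [mem_roots hT0]
        exact hTY i (by omega)
      · apply Multiset.Nodup.map_on _ (range (n+1)).nodup
        intro i hi j hj hij
        simp only [Finset.mem_val, Finset.mem_range] at hi hj
        exact hY i (by omega) j (by omega) hij)
    rw [Multiset.map_map] at h3
    exact h3
  obtain ⟨L, hL⟩ := hdvd
  have hLd : ∃ a, L = C a := by
    by_cases hL0 : L = 0
    · exact ⟨0, by simp [hL0]⟩
    · refine ⟨L.coeff 0, eq_C_of_natDegree_eq_zero ?_⟩
      rw [hL, (hAm.mul hBm).natDegree_mul' hL0, hAm.natDegree_mul hBm, hAd, hBd] at hTd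
      omega
  obtain ⟨a, rfl⟩ := hLd
  set u : R[X] := ∑ l ∈ range q, C (v l) * X ^ l with hu
  set w : R[X] := ∑ l ∈ range (n - q), C (v (q + l)) * X ^ l with hw
  have hΔ : T.comp (X + C z) - T = C z * (u * A.comp (X + C z) + w * B) := by
    have e : T.comp (X + C z) - T = ∑ l ∈ range n, C (v l) * ((H l).comp (X + C z) - H l) := by
      rw [hT, hT0]
      simp [mul_sub, Finset.sum_sub_distrib, Polynomial.sum_comp]
    have e' : ∑ l ∈ range n, C (v l) * ((H l).comp (X + C z) - H l)
        = ∑ l ∈ range (q + (n - q)), C (v l) * ((H l).comp (X + C z) - H l) := by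
      rw [show q + (n - q) = n by omega]
    rw [e, e', Finset.sum_range_add, hu, hw]
    rw [mul_add, Finset.sum_mul, Finset.sum_mul, Finset.mul_sum, Finset.mul_sum]
    congr 1
    · apply Finset.sum_congr rfl
      intro l hl
      rw [hHA l (by simpa using hl)]; ring
    · apply Finset.sum_congr rfl
      intro l hl
      rw [Finset.mem_range] at hl
      rw [hHB (q+l) (by omega) (by omega), Nat.add_sub_cancel_left]; ring
  set ΔA := A.comp (X + C z) - A with hΔA
  set ΔB := B.comp (X + C z) - B with hΔB
  have key : A.comp (X + C z) * (C z * u - C a * ΔB) = B * (C a * ΔA - C z * w) := by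
    rw [hL] at hΔ
    simp only [mul_comp, C_comp] at hΔ
    rw [hΔA, hΔB]
    linear_combination -hΔ
  set D := C a * ΔA - C z * w with hD
  have hAcd : (A.comp (X + C z)).natDegree = k := by rw [natDegree_comp, hAd]; simp
  have hAcm : (A.comp (X + C z)).Monic := hAm.comp_X_add_C z
  have hΔAd : ΔA.degree < k := by
    rw [hΔA, ← hAd, ← degree_eq_natDegree hAm.ne_zero]
    have : (A.comp (X + C z)).degree = A.degree := by
      rw [degree_eq_natDegree hAm.ne_zero, degree_eq_natDegree hAcm.ne_zero, hAd, hAcd]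
    rw [← this]
    apply degree_sub_lt_left this hAcm.ne_zero
    rw [hAm.leadingCoeff, hAcm.leadingCoeff]
  have hwd : w.degree < k := by
    rw [hw]
    refine (degree_sum_le _ _).trans_lt ?_
    refine (Finset.sup_lt_iff (WithBot.bot_lt_coe k)).2 ?_
    intro l hl
    refine (degree_C_mul_X_pow_le _ _).trans_lt ?_
    rw [Finset.mem_range] at hl
    exact WithBot.coe_lt_coe.2 (by omega : l < k)
  have hCd : ∀ (c : R) (P : R[X]), (C c * P).degree ≤ P.degree := by
    intro c P
    rw [← smul_eq_C_mul]
    exact degree_smul_le _ _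
  have hDd : D.degree < k := by
    rw [hD]
    refine (degree_sub_le _ _).trans_lt (max_lt ?_ ?_)
    · exact (hCd _ _).trans_lt hΔAd
    · exact (hCd _ _).trans_lt hwd
  have hD0 : D = 0 := by
    apply eq_zero_of_degree_lt_of_eval_finset_eq_zero ((range k).image (fun i => Y i - z))
    · rw [Finset.card_image_of_injOn]
      · simpa using hDd
      · intro i hi j hj hij
        simp only [Finset.coe_range, Set.mem_Iio] at hi hj
        exact hY i (by omega) j (by omega) (by simpa using hij)
    · intro x hx
      rw [Finset.mem_image] at hx
      obtain ⟨i, hi, rfl⟩ := hx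
      have e := congrArg (eval (Y i - z)) key
      simp only [eval_mul, eval_comp, eval_add, eval_X, eval_C, sub_add_cancel] at e
      have e2 : A.eval (Y i) = 0 := by
        rw [hA, eval_prod]
        exact Finset.prod_eq_zero hi (by simp)
      rw [e2, zero_mul] at e
      rcases mul_eq_zero.1 e.symm with e3 | e3
      · exfalso
        rw [hB, eval_prod, Finset.prod_eq_zero_iff] at e3
        obtain ⟨j, hj, e3⟩ := e3
        simp only [eval_sub, eval_X, eval_C, sub_eq_zero] at e3
        rw [Finset.mem_Ico] at hj
        exact hYz i (by simpa using hi) j hj.1 (by omega) e3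
      · exact e3
  have hΔAc : ΔA.coeff (k - 1) = k * z := by
    have e1 := prod_X_sub_C_coeff_card_pred (range k) Y (by simp; omega)
    have e2 := prod_X_sub_C_coeff_card_pred (range k) (fun i => Y i - z) (by simp; omega)
    have e3 : A.comp (X + C z) = ∏ i ∈ range k, (X - C (Y i - z)) := by
      rw [hA, Polynomial.prod_comp]
      apply Finset.prod_congr rfl
      intro i _
      simp
      ring
    rw [Finset.card_range] at e1 e2
    rw [hΔA, coeff_sub, e3, hA, e1, e2, Finset.sum_sub_distrib]
    simp
  have hwc : w.coeff (k - 1) = 0 := by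
    rw [hw, finsetSum_coeff]
    apply Finset.sum_eq_zero
    intro l hl
    rw [Finset.mem_range] at hl
    rw [coeff_C_mul_X_pow, if_neg (by omega)]
  have ha : a = 0 := by
    have e := congrArg (fun P => coeff P (k-1)) hD0
    simp only [hD, coeff_sub, coeff_C_mul, hΔAc, hwc, mul_zero, sub_zero, coeff_zero] at e
    have hk : (k : R) ≠ 0 := by exact_mod_cast (by omega : k ≠ 0)
    simpa [hz, hk] using e
  have hw0 : w = 0 := by
    rw [hD, ha] at hD0
    simpa [hz] using hD0
  have hu0 : u = 0 := by
    rw [hD0, ha] at key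
    simpa [hz, hAcm.ne_zero] using key
  intro l hl
  by_cases hlq : l < q
  · have e := congrArg (fun P => coeff P l) hu0
    simp only [hu, finsetSum_coeff, coeff_C_mul_X_pow, coeff_zero] at e
    simpa [hlq] using e
  · have e := congrArg (fun P => coeff P (l - q)) hw0
    simp only [hw, finsetSum_coeff, coeff_C_mul_X_pow, coeff_zero] at e
    rw [Finset.sum_ite_eq, if_pos (by rw [Finset.mem_range]; omega)] at e
    rwa [show q + (l - q) = l by omega] at e

/-- Total weight (in the variables of `S` together with the polynomial variable) at most `d`. -/
def Wt {σ : Type} (d : ℕ) (P : Polynomial (MvPolynomial σ ℚ)) : Prop :=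
  ∀ j, P.coeff j ≠ 0 → (P.coeff j).totalDegree + j ≤ d

lemma Wt.mono {σ : Type} {d e : ℕ} {P : Polynomial (MvPolynomial σ ℚ)} (h : Wt d P) (hde : d ≤ e) :
    Wt e P := fun j hj => (h j hj).trans hde

lemma Wt.zero {σ : Type} (d : ℕ) : Wt d (0 : Polynomial (MvPolynomial σ ℚ)) := by
  intro j hj; simp at hj

lemma Wt.add {σ : Type} {d : ℕ} {P P' : Polynomial (MvPolynomial σ ℚ)} (h : Wt d P) (h' : Wt d P') :
    Wt d (P + P') := by
  intro j hj
  rw [Polynomial.coeff_add] at hj ⊢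
  by_cases h1 : P.coeff j = 0
  · rw [h1, zero_add] at hj ⊢
    exact h' j hj
  by_cases h2 : P'.coeff j = 0
  · rw [h2, add_zero] at hj ⊢
    exact h j hj
  have e1 := h j h1
  have e2 := h' j h2
  have e3 := MvPolynomial.totalDegree_add (P.coeff j) (P'.coeff j)
  rcases le_max_iff.1 e3 with e | e <;> omega

lemma Wt.sum {σ ι : Type} {d : ℕ} (s : Finset ι) (P : ι → Polynomial (MvPolynomial σ ℚ))
    (h : ∀ i ∈ s, Wt d (P i)) : Wt d (∑ i ∈ s, P i) := by
  classical
  induction s using Finset.induction_on with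
  | empty => simpa using Wt.zero d
  | insert a s ha ih =>
    rw [Finset.sum_insert ha]
    exact (h a (Finset.mem_insert_self _ _)).add
      (ih (fun i hi => h i (Finset.mem_insert_of_mem hi)))

lemma Wt.C {σ : Type} {d : ℕ} {c : MvPolynomial σ ℚ} (h : c.totalDegree ≤ d) :
    Wt d (Polynomial.C c) := by
  intro j hj
  rw [Polynomial.coeff_C] at hj ⊢
  split_ifs at hj ⊢ with h0
  · omega
  · exact absurd rfl hj

lemma Wt.X {σ : Type} : Wt 1 (Polynomial.X : Polynomial (MvPolynomial σ ℚ)) := by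
  intro j hj
  rw [Polynomial.coeff_X] at hj ⊢
  split_ifs at hj ⊢ with h0
  · simp; omega
  · exact absurd rfl hj

lemma Wt.mul {σ : Type} {d e : ℕ} {P P' : Polynomial (MvPolynomial σ ℚ)} (h : Wt d P) (h' : Wt e P') :
    Wt (d + e) (P * P') := by
  intro j hj
  rw [Polynomial.coeff_mul] at hj ⊢
  have hle : ∀ x ∈ Finset.HasAntidiagonal.antidiagonal j, P.coeff x.1 * P'.coeff x.2 ≠ 0 →
      (P.coeff x.1 * P'.coeff x.2).totalDegree + j ≤ d + e := by
    intro x hx hx0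
    have e1 := h _ (left_ne_zero_of_mul hx0)
    have e2 := h' _ (right_ne_zero_of_mul hx0)
    have e3 := MvPolynomial.totalDegree_mul (P.coeff x.1) (P'.coeff x.2)
    rw [Finset.HasAntidiagonal.mem_antidiagonal] at hx
    omega
  obtain ⟨x, hx, hx0⟩ := Finset.exists_ne_zero_of_sum_ne_zero hj
  have hj' : j ≤ d + e := le_trans (Nat.le_add_left _ _) (hle x hx hx0)
  have : (∑ x ∈ Finset.HasAntidiagonal.antidiagonal j, P.coeff x.1 * P'.coeff x.2).totalDegree ≤ d + e - j := by
    apply MvPolynomial.totalDegree_finsetSum_le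
    intro y hy
    by_cases hy0 : P.coeff y.1 * P'.coeff y.2 = 0
    · rw [hy0]; simp
    · have := hle y hy hy0
      omega
  omega

lemma Wt.neg {σ : Type} {d : ℕ} {P : Polynomial (MvPolynomial σ ℚ)} (h : Wt d P) : Wt d (-P) := by
  intro j hj
  rw [Polynomial.coeff_neg] at hj ⊢
  rw [MvPolynomial.totalDegree_neg]
  exact h j (by simpa using hj)

lemma Wt.sub {σ : Type} {d : ℕ} {P P' : Polynomial (MvPolynomial σ ℚ)} (h : Wt d P) (h' : Wt d P') :
    Wt d (P - P') := by
  rw [sub_eq_add_neg]; exact h.add h'.neg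

lemma Wt.one {σ : Type} : Wt 0 (1 : Polynomial (MvPolynomial σ ℚ)) := by
  have := Wt.C (σ := σ) (d := 0) (c := 1) (by simp)
  simpa using this

lemma Wt.pow {σ : Type} {d : ℕ} {P : Polynomial (MvPolynomial σ ℚ)} (h : Wt d P) (m : ℕ) :
    Wt (m * d) (P ^ m) := by
  induction m with
  | zero => simpa using Wt.one
  | succ m ih =>
    rw [pow_succ, Nat.succ_mul]
    exact ih.mul h

lemma Wt.Xpow {σ : Type} (m : ℕ) : Wt m ((Polynomial.X : Polynomial (MvPolynomial σ ℚ)) ^ m) := by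
  simpa using Wt.X.pow m

lemma Wt.prod_X_sub_C {σ ι : Type} (s : Finset ι) (y : ι → MvPolynomial σ ℚ)
    (hy : ∀ i ∈ s, (y i).totalDegree ≤ 1) :
    Wt s.card (∏ i ∈ s, (Polynomial.X - Polynomial.C (y i))) := by
  classical
  induction s using Finset.induction_on with
  | empty => simpa using Wt.one
  | insert a s ha ih =>
    rw [Finset.prod_insert ha, Finset.card_insert_of_notMem ha, add_comm]
    exact (Wt.X.sub (Wt.C (hy a (Finset.mem_insert_self _ _)))).mul
      (ih (fun i hi => hy i (Finset.mem_insert_of_mem hi)))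

lemma Wt.natDegree_le {σ : Type} {d : ℕ} {P : Polynomial (MvPolynomial σ ℚ)} (h : Wt d P) :
    P.natDegree ≤ d := by
  by_cases hP : P = 0
  · simp [hP]
  · have := h P.natDegree (by simpa using hP)
    omega

lemma Wt.eval {σ : Type} {d : ℕ} {P : Polynomial (MvPolynomial σ ℚ)} (h : Wt d P)
    {y : MvPolynomial σ ℚ} (hy : y.totalDegree ≤ 1) : (P.eval y).totalDegree ≤ d := by
  rw [Polynomial.eval_eq_sum, Polynomial.sum]
  apply MvPolynomial.totalDegree_finsetSum_le
  intro j hj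
  have h1 := h j (by simpa using hj)
  have h2 := MvPolynomial.totalDegree_mul (P.coeff j) (y ^ j)
  have h3 := MvPolynomial.totalDegree_pow y j
  have h4 : j * y.totalDegree ≤ j * 1 := Nat.mul_le_mul_left _ hy
  omega

open Polynomial in
lemma exists_antidiff_X {σ : Type} (z : MvPolynomial σ ℚ) (hz : z.totalDegree ≤ 1) (m : ℕ) :
    ∃ P : Polynomial (MvPolynomial σ ℚ), Wt (m + 1) P ∧
      P.comp (X + C z) - P = C z * X ^ m := by
  induction m using Nat.strong_induction_on with
  | _ m ih =>
    choose! E hE using ih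
    refine ⟨C (MvPolynomial.C ((m + 1 : ℚ)⁻¹)) * (X ^ (m + 1) -
      ∑ j ∈ Finset.range m, C ((((m + 1).choose j : ℕ) : MvPolynomial σ ℚ) * z ^ (m - j)) * E j), ?_, ?_⟩
    · have h0 : Wt 0 (C (MvPolynomial.C ((m + 1 : ℚ)⁻¹) : MvPolynomial σ ℚ)) := Wt.C (by simp)
      refine Wt.mono (d := 0 + (m + 1)) (h0.mul (Wt.sub ?_ (Wt.sum _ _ ?_))) (by omega)
      · simpa using Wt.Xpow (σ := σ) (m + 1)
      · intro j hj
        rw [Finset.mem_range] at hj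
        have h1 : Wt (m - j) (C ((((m + 1).choose j : ℕ) : MvPolynomial σ ℚ) * z ^ (m - j))) := by
          apply Wt.C
          refine (MvPolynomial.totalDegree_mul _ _).trans ?_
          have e1 : ((((m + 1).choose j : ℕ) : MvPolynomial σ ℚ)).totalDegree = 0 := by
            rw [← map_natCast (MvPolynomial.C (σ := σ) (R := ℚ))]
            exact MvPolynomial.totalDegree_C _
          have e2 := MvPolynomial.totalDegree_pow z (m - j)
          have e3 : (m - j) * z.totalDegree ≤ (m - j) * 1 := Nat.mul_le_mul_left _ hz
          omega
        exact (h1.mul (hE j hj).1).mono (by omega)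
    · have hs : ∀ j ∈ Finset.range m,
          C ((((m + 1).choose j : ℕ) : MvPolynomial σ ℚ) * z ^ (m - j)) * ((E j).comp (X + C z) - E j)
          = X ^ j * (C z) ^ (m + 1 - j) * (((m+1).choose j : ℕ) : Polynomial (MvPolynomial σ ℚ)) := by
        intro j hj
        rw [Finset.mem_range] at hj
        rw [(hE j hj).2, show m + 1 - j = (m - j) + 1 by omega, pow_succ]
        simp only [C_mul, C_pow, map_natCast]
        ring
      have hb := add_pow (X : Polynomial (MvPolynomial σ ℚ)) (C z) (m + 1)
      rw [Finset.sum_range_succ, Finset.sum_range_succ, ← Finset.sum_congr rfl hs] at hb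
      simp only [mul_sub, Finset.sum_sub_distrib] at hb
      have hm1 : C (MvPolynomial.C ((m + 1 : ℚ)⁻¹) : MvPolynomial σ ℚ) *
          ((m : Polynomial (MvPolynomial σ ℚ)) + 1) = 1 := by
        have e : ((m : Polynomial (MvPolynomial σ ℚ)) + 1) = C (MvPolynomial.C (m + 1 : ℚ)) := by simp
        rw [e, ← C_mul, ← MvPolynomial.C_mul, inv_mul_cancel₀ (by positivity)]
        simp
      simp only [mul_comp, C_comp, sub_comp, Polynomial.sum_comp, pow_comp, X_comp]
      rw [hb]
      simp only [Nat.choose_succ_self_right, Nat.choose_self, Nat.sub_self, Nat.add_sub_cancel_left, pow_zero, pow_one]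
      push_cast
      linear_combination (C z * X ^ m) * hm1

open Polynomial in
lemma exists_antidiff {σ : Type} (z : MvPolynomial σ ℚ) (hz : z.totalDegree ≤ 1) (d : ℕ)
    (W : Polynomial (MvPolynomial σ ℚ)) (hW : Wt d W) :
    ∃ P : Polynomial (MvPolynomial σ ℚ), Wt (d + 1) P ∧
      P.comp (X + C z) - P = C z * W := by
  choose E hE1 hE2 using exists_antidiff_X z hz
  refine ⟨∑ j ∈ W.support, C (W.coeff j) * E j, ?_, ?_⟩
  · apply Wt.sum
    intro j hj
    have h1 := hW j (by simpa using hj)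
    have h2 : Wt (d - j) (C (W.coeff j)) := Wt.C (by omega)
    exact (h2.mul (hE1 j)).mono (by omega)
  · conv_rhs => rw [W.as_sum_support_C_mul_X_pow]
    rw [Polynomial.sum_comp, ← Finset.sum_sub_distrib, Finset.mul_sum]
    apply Finset.sum_congr rfl
    intro j _
    rw [mul_comp, C_comp, ← mul_sub, hE2]
    ring

lemma almostPath_adj {n k : ℕ} (a b : Fin (n + 1)) : (almostPath n k).Adj a b ↔
    a.val ≠ b.val ∧ (((a.val + 1 = b.val ∧ b.val < n) ∨ (a.val = k - 1 ∧ b.val = n)) ∨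
      ((b.val + 1 = a.val ∧ a.val < n) ∨ (b.val = k - 1 ∧ a.val = n))) := by
  rw [almostPath, SimpleGraph.fromRel_adj, ne_eq, ne_eq, Fin.ext_iff]

lemma conn_pred {N : ℕ} {G : SimpleGraph (Fin N)} {I : Finset (Fin N)} (h : ConnSet G I)
    (P : Fin N → Prop) (hP : ∀ a ∈ I, ∀ b ∈ I, G.Adj a b → P a → P b)
    (a b : Fin N) (ha : a ∈ I) (hb : b ∈ I) (hPa : P a) : P b := by
  have hr := h.2.preconnected ⟨a, by simpa using ha⟩ ⟨b, by simpa using hb⟩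
  rw [SimpleGraph.reachable_iff_reflTransGen] at hr
  have : ∀ c, Relation.ReflTransGen (G.induce (↑I : Set (Fin N))).Adj ⟨a, by simpa using ha⟩ c →
      P c.1 := by
    intro c hc
    induction hc with
    | refl => exact hPa
    | @tail x y _ hxy ih =>
      exact hP x.1 (by simpa using x.2) y.1 (by simpa using y.2) (by simpa using hxy) ih
  exact this _ hr

lemma conn_convex {n k : ℕ} (h1 : 1 < k) (h2 : k < n) {I : Finset (Fin (n + 1))}
    (h : ConnSet (almostPath n k) I) (a b c : Fin (n + 1)) (ha : a ∈ I) (hc : c ∈ I)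
    (hab : a.val < b.val) (hbc : b.val < c.val) (hcn : c.val < n) : b ∈ I := by
  by_contra hb
  have := conn_pred h (fun v => (v.val < n ∧ v.val < b.val) ∨ (v.val = n ∧ k - 1 < b.val)) (by
    intro x hx y hy hxy hPx
    rw [almostPath_adj] at hxy
    have hxb : x.val ≠ b.val := fun e => hb (Fin.ext e ▸ hx)
    have hyb : y.val ≠ b.val := fun e => hb (Fin.ext e ▸ hy)
    have := x.2
    have := y.2
    omega) a c ha hc (by omega)
  omega

lemma conn_mem_k {n k : ℕ} (h1 : 1 < k) (h2 : k < n) {I : Finset (Fin (n + 1))}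
    (h : ConnSet (almostPath n k) I) (a c : Fin (n + 1)) (ha : a ∈ I) (hc : c ∈ I)
    (han : a.val = n) (hcn : c.val < n) : (⟨k - 1, by omega⟩ : Fin (n + 1)) ∈ I := by
  by_contra hb
  have := conn_pred h (fun v => v.val = n) (by
    intro x hx y hy hxy hPx
    rw [almostPath_adj] at hxy
    have hyb : y.val ≠ k - 1 := fun e => hb (by
      have : y = ⟨k - 1, by omega⟩ := Fin.ext e
      exact this ▸ hy)
    omega) a c ha hc han
  omega

/-- Classification of connected vertex sets of the almost path graph. -/
lemma conn_classify {n k : ℕ} (h1 : 1 < k) (h2 : k < n) {I : Finset (Fin (n + 1))}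
    (h : ConnSet (almostPath n k) I) :
    (∃ i j, i < j ∧ j ≤ n ∧ ∀ v : Fin (n + 1), v ∈ I ↔ i ≤ v.val ∧ v.val < j) ∨
    (∀ v : Fin (n + 1), v ∈ I ↔ v.val = n) ∨
    (∃ i j, i < k ∧ k ≤ j ∧ j ≤ n ∧
      ∀ v : Fin (n + 1), v ∈ I ↔ (i ≤ v.val ∧ v.val < j) ∨ v.val = n) := by
  classical
  set I' := I.filter (fun v => v.val < n) with hI'
  have hmem : ∀ v, v ∈ I' ↔ v ∈ I ∧ v.val < n := by intro v; simp [hI']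
  by_cases hne : I'.Nonempty
  · set i := I'.min' hne
    set j := I'.max' hne
    have hi := (hmem _).1 (I'.min'_mem hne)
    have hj := (hmem _).1 (I'.max'_mem hne)
    have hint : ∀ v : Fin (n + 1), v.val < n → (v ∈ I ↔ i.val ≤ v.val ∧ v.val < j.val + 1) := by
      intro v hv
      constructor
      · intro hvI
        have e1 : i ≤ v := I'.min'_le v ((hmem v).2 ⟨hvI, hv⟩)
        have e2 : v ≤ j := I'.le_max' v ((hmem v).2 ⟨hvI, hv⟩)
        rw [Fin.le_def] at e1 e2
        omega
      · rintro ⟨e1, e2⟩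
        by_cases e3 : i.val = v.val
        · rw [← Fin.ext e3]; exact hi.1
        by_cases e4 : j.val = v.val
        · rw [← Fin.ext e4]; exact hj.1
        exact conn_convex h1 h2 h i v j hi.1 hj.1 (by omega) (by omega) hj.2
    have hij : i.val < j.val + 1 := ((hint i hi.2).1 hi.1).2
    have hjn : j.val < n := hj.2
    by_cases hn : Fin.last n ∈ I
    · right; right
      have hk := conn_mem_k h1 h2 h (Fin.last n) i hn hi.1 rfl hi.2
      have hk' := (hint _ (by simp only; omega)).1 hk
      simp only at hk'
      refine ⟨i.val, j.val + 1, by omega, by omega, by omega, ?_⟩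
      intro v
      by_cases hv : v.val < n
      · rw [hint v hv]; omega
      · have : v = Fin.last n := Fin.ext (by have := v.2; simp; omega)
        rw [this]
        simp [hn]
    · left
      refine ⟨i.val, j.val + 1, by omega, by omega, ?_⟩
      intro v
      by_cases hv : v.val < n
      · exact hint v hv
      · have : v = Fin.last n := Fin.ext (by have := v.2; simp; omega)
        rw [this]
        simp only [hn, Fin.val_last, false_iff]
        omega
  · right; left
    intro v
    have hall : ∀ w ∈ I, w.val = n := by
      intro w hw
      by_contra hwn
      exact hne ⟨w, (hmem w).2 ⟨hw, by have := w.2; omega⟩⟩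
    constructor
    · exact hall v
    · intro hv
      obtain ⟨w, hw⟩ := h.1
      have : v = w := Fin.ext (by rw [hv, hall w hw])
      rwa [this]

lemma conn_of_reach {N : ℕ} {G : SimpleGraph (Fin N)} {I : Finset (Fin N)} (a : Fin N) (ha : a ∈ I)
    (h : ∀ b (hb : b ∈ I), (G.induce (↑I : Set (Fin N))).Reachable ⟨b, by simpa using hb⟩ ⟨a, by simpa using ha⟩) :
    ConnSet G I := by
  refine ⟨⟨a, ha⟩, ?_⟩
  have : Nonempty (↑(↑I : Set (Fin N))) := ⟨⟨a, by simpa using ha⟩⟩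
  refine SimpleGraph.Connected.mk ?_
  rintro ⟨b, hb⟩ ⟨c, hc⟩
  exact (h b (by simpa using hb)).trans (h c (by simpa using hc)).symm

lemma reach_interval {n k : ℕ} {I : Finset (Fin (n + 1))} (i j : ℕ) (hjn : j ≤ n)
    (hI : ∀ v : Fin (n + 1), i ≤ v.val → v.val < j → v ∈ I) (d : ℕ) :
    ∀ (hd : i + d < j), ((almostPath n k).induce (↑I : Set (Fin (n + 1)))).Reachable
      ⟨⟨i + d, by omega⟩, by simpa using hI ⟨i + d, by omega⟩ (by simp) (by simpa using hd)⟩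
      ⟨⟨i, by omega⟩, by simpa using hI ⟨i, by omega⟩ (by simp) (by simp only; omega)⟩ := by
  induction d with
  | zero => intro _; exact SimpleGraph.Reachable.refl _
  | succ d ih =>
    intro hd
    refine SimpleGraph.Reachable.trans (SimpleGraph.Adj.reachable ?_) (ih (by omega))
    simp only [SimpleGraph.comap_adj, Function.Embedding.subtype_apply]
    rw [almostPath_adj]
    simp only
    omega

lemma conn_interval {n k : ℕ} {I : Finset (Fin (n + 1))} (i j : ℕ) (hij : i < j) (hjn : j ≤ n)
    (hI : ∀ v : Fin (n + 1), v ∈ I ↔ i ≤ v.val ∧ v.val < j) : ConnSet (almostPath n k) I := by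
  have hI' : ∀ v : Fin (n + 1), i ≤ v.val → v.val < j → v ∈ I := fun v h h' => (hI v).2 ⟨h, h'⟩
  refine conn_of_reach ⟨i, by omega⟩ (hI' _ (by simp) (by simpa using hij)) ?_
  intro b hb
  have hb' := (hI b).1 hb
  have := reach_interval (k := k) i j hjn hI' (b.val - i) (by omega)
  convert this
  omega

lemma conn_interval' {n k : ℕ} (h1 : 1 < k) (h2 : k < n) {I : Finset (Fin (n + 1))} (i j : ℕ)
    (hik : i < k) (hkj : k ≤ j) (hjn : j ≤ n)
    (hI : ∀ v : Fin (n + 1), v ∈ I ↔ (i ≤ v.val ∧ v.val < j) ∨ v.val = n) :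
    ConnSet (almostPath n k) I := by
  have hI' : ∀ v : Fin (n + 1), i ≤ v.val → v.val < j → v ∈ I := fun v h h' => (hI v).2 (Or.inl ⟨h, h'⟩)
  refine conn_of_reach ⟨i, by omega⟩ (hI' _ (by simp) (by simp only; omega)) ?_
  intro b hb
  rcases (hI b).1 hb with hb' | hb'
  · have := reach_interval (k := k) i j hjn hI' (b.val - i) (by omega)
    convert this
    omega
  · have := reach_interval (k := k) i j hjn hI' (k - 1 - i) (by omega)
    refine SimpleGraph.Reachable.trans (SimpleGraph.Adj.reachable ?_) this
    simp only [SimpleGraph.comap_adj, Function.Embedding.subtype_apply]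
    rw [almostPath_adj]
    simp only
    omega

lemma conn_single {n k : ℕ} {I : Finset (Fin (n + 1))}
    (hI : ∀ v : Fin (n + 1), v ∈ I ↔ v.val = n) : ConnSet (almostPath n k) I := by
  refine conn_of_reach (Fin.last n) ((hI _).2 rfl) ?_
  intro b hb
  have : b = Fin.last n := Fin.ext ((hI b).1 hb)
  subst this
  exact SimpleGraph.Reachable.refl _

/-- The variables indexed by naturals (zero out of range). -/
noncomputable def xv (n i : ℕ) : MvPolynomial (Fin (n + 1)) ℚ :=
  if h : i < n + 1 then MvPolynomial.X ⟨i, h⟩ else 0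

/-- Partial sums of the path variables. -/
noncomputable def yv (n j : ℕ) : MvPolynomial (Fin (n + 1)) ℚ := ∑ i ∈ range j, xv n i

lemma xv_val {n : ℕ} (v : Fin (n + 1)) : xv n v.val = MvPolynomial.X v := by
  rw [xv, dif_pos v.2]

lemma xv_degree (n i : ℕ) : (xv n i).totalDegree ≤ 1 := by
  unfold xv
  split_ifs <;> simp

lemma yv_degree (n j : ℕ) : (yv n j).totalDegree ≤ 1 :=
  MvPolynomial.totalDegree_finsetSum_le (fun i _ => xv_degree n i)

lemma sum_int {n : ℕ} {M : Type*} [AddCommMonoid M] (f : ℕ → M) {I : Finset (Fin (n + 1))} {i j : ℕ}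
    (hjn : j ≤ n) (hI : ∀ v : Fin (n + 1), v ∈ I ↔ i ≤ v.val ∧ v.val < j) :
    ∑ v ∈ I, f v.val = ∑ m ∈ Ico i j, f m := by
  have : Ico i j = I.map Fin.valEmbedding := by
    ext m
    simp only [mem_Ico, mem_map, Fin.valEmbedding_apply]
    constructor
    · intro hm
      exact ⟨⟨m, by omega⟩, (hI _).2 hm, rfl⟩
    · rintro ⟨v, hv, rfl⟩
      exact (hI v).1 hv
  rw [this, sum_map]
  rfl

lemma sum_int' {n : ℕ} {M : Type*} [AddCommMonoid M] (f : ℕ → M) {I : Finset (Fin (n + 1))} {i j : ℕ}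
    (hjn : j ≤ n) (hI : ∀ v : Fin (n + 1), v ∈ I ↔ (i ≤ v.val ∧ v.val < j) ∨ v.val = n) :
    ∑ v ∈ I, f v.val = ∑ m ∈ Ico i j, f m + f n := by
  classical
  have h0 : Fin.last n ∈ I := (hI _).2 (Or.inr rfl)
  rw [← sum_erase_add _ _ h0, sum_int (I := I.erase (Fin.last n)) f hjn]
  · rfl
  · intro v
    rw [mem_erase, hI, ne_eq, Fin.ext_iff, Fin.val_last]
    omega

lemma sum_xv {n i j : ℕ} (hij : i ≤ j) : ∑ m ∈ Ico i j, xv n m = yv n j - yv n i := by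
  rw [yv, yv, sum_Ico_eq_sub _ hij]

/-- The coefficients of the derivation `y ↦ H(y)`. -/
noncomputable def rowH (n : ℕ) (H : Polynomial (MvPolynomial (Fin (n + 1)) ℚ)) (m : ℕ) :
    MvPolynomial (Fin (n + 1)) ℚ :=
  if m < n then H.eval (yv n (m + 1)) - H.eval (yv n m) else 0

lemma sum_rowH {n i j : ℕ} (H : Polynomial (MvPolynomial (Fin (n + 1)) ℚ)) (hij : i ≤ j) (hjn : j ≤ n) :
    ∑ m ∈ Ico i j, rowH n H m = H.eval (yv n j) - H.eval (yv n i) := by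
  rw [← sum_Ico_sub (fun m => H.eval (yv n m)) hij]
  apply sum_congr rfl
  intro m hm
  rw [mem_Ico] at hm
  rw [rowH, if_pos (by omega)]

lemma form_int {n i j : ℕ} {I : Finset (Fin (n + 1))} (hij : i ≤ j) (hjn : j ≤ n)
    (hI : ∀ v : Fin (n + 1), v ∈ I ↔ i ≤ v.val ∧ v.val < j) :
    ∑ v ∈ I, (MvPolynomial.X v : MvPolynomial (Fin (n + 1)) ℚ) = yv n j - yv n i := by
  rw [← sum_xv hij, ← sum_int (xv n) hjn hI]
  simp only [xv_val]

lemma form_int' {n i j : ℕ} {I : Finset (Fin (n + 1))} (hij : i ≤ j) (hjn : j ≤ n)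
    (hI : ∀ v : Fin (n + 1), v ∈ I ↔ (i ≤ v.val ∧ v.val < j) ∨ v.val = n) :
    ∑ v ∈ I, (MvPolynomial.X v : MvPolynomial (Fin (n + 1)) ℚ) = yv n j - yv n i + xv n n := by
  rw [← sum_xv hij, ← sum_int' (xv n) hjn hI]
  simp only [xv_val]

lemma rowH_mem {n k : ℕ} (h1 : 1 < k) (h2 : k < n) (H : Polynomial (MvPolynomial (Fin (n + 1)) ℚ))
    (hH : ∀ i j, i < k → k ≤ j → j ≤ n →
      yv n j - yv n i + xv n n ∣ H.eval (yv n j) - H.eval (yv n i)) :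
    MvPolynomial.mkDerivation ℚ (fun v : Fin (n + 1) => rowH n H v.val) ∈
      derModule (almostPath n k) := by
  intro I hI
  rw [map_sum]
  simp only [MvPolynomial.mkDerivation_X]
  rcases conn_classify h1 h2 hI with ⟨i, j, hij, hjn, hm⟩ | hm | ⟨i, j, hik, hkj, hjn, hm⟩
  · rw [form_int hij.le hjn hm, sum_int (rowH n H) hjn hm, sum_rowH H hij.le hjn]
    exact Polynomial.sub_dvd_eval_sub _ _ _
  · have h0 : ∑ v ∈ I, rowH n H v.val = 0 := by
      apply sum_eq_zero
      intro v hv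
      rw [rowH, if_neg (by have := (hm v).1 hv; omega)]
    rw [h0]
    exact dvd_zero _
  · rw [form_int' (by omega) hjn hm, sum_int' (rowH n H) hjn hm, sum_rowH H (by omega) hjn]
    have : rowH n H n = 0 := by simp [rowH]
    rw [this, add_zero]
    exact hH i j hik hkj hjn

lemma yv_ne {n i j : ℕ} (hij : i < j) (hjn : j ≤ n) : yv n j - yv n i ≠ 0 := by
  classical
  set I : Finset (Fin (n + 1)) := univ.filter (fun v => i ≤ v.val ∧ v.val < j) with hI
  rw [← form_int (I := I) hij.le hjn (by simp [hI])]
  exact (linS_irred I ⟨⟨i, by omega⟩, by simp [hI, hij]⟩).ne_zero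

lemma yv_ne' {n i j : ℕ} (hij : i ≤ j) (hjn : j ≤ n) : yv n j - yv n i + xv n n ≠ 0 := by
  classical
  set I : Finset (Fin (n + 1)) := univ.filter (fun v => (i ≤ v.val ∧ v.val < j) ∨ v.val = n) with hI
  rw [← form_int' (I := I) hij hjn (by simp [hI])]
  exact (linS_irred I ⟨Fin.last n, by simp [hI]⟩).ne_zero

lemma yv_inj {n : ℕ} : ∀ i ≤ n, ∀ j ≤ n, yv n i = yv n j → i = j := by
  intro i hi j hj h
  rcases lt_trichotomy i j with h' | h' | h'
  · exact absurd (sub_eq_zero.2 h.symm) (yv_ne h' hj)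
  · exact h'
  · exact absurd (sub_eq_zero.2 h) (yv_ne h' hi)

/-- The index set of the hyperplanes. -/
def hypIdx (n k : ℕ) : Finset ((Σ _ : ℕ, ℕ) ⊕ ((ℕ × ℕ) ⊕ Unit)) :=
  ((range (n + 1)).sigma (fun j => range j)).disjSum
    ((range k ×ˢ Ico k (n + 1)).disjSum {()})

/-- The vertex sets of the hyperplanes. -/
def hypSet (n : ℕ) : ((Σ _ : ℕ, ℕ) ⊕ ((ℕ × ℕ) ⊕ Unit)) → Finset (Fin (n + 1)) :=
  Sum.elim (fun s => univ.filter (fun v => s.2 ≤ v.val ∧ v.val < s.1))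
    (Sum.elim (fun s => univ.filter (fun v => (s.1 ≤ v.val ∧ v.val < s.2) ∨ v.val = n))
      (fun _ => univ.filter (fun v => v.val = n)))

lemma hypSet_conn {n k : ℕ} (h1 : 1 < k) (h2 : k < n) :
    ∀ s ∈ hypIdx n k, ConnSet (almostPath n k) (hypSet n s) := by
  rintro (⟨j, i⟩ | ⟨i, j⟩ | _) hs
  · simp [hypIdx] at hs
    exact conn_interval i j (by omega) (by omega) (by simp [hypSet])
  · simp [hypIdx] at hs
    exact conn_interval' h1 h2 i j (by omega) (by omega) (by omega) (by simp [hypSet])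
  · exact conn_single (by simp [hypSet])

lemma hypSet_inj {n k : ℕ} (h1 : 1 < k) (h2 : k < n) :
    ∀ s ∈ hypIdx n k, ∀ t ∈ hypIdx n k, hypSet n s = hypSet n t → s = t := by
  rintro (⟨j, i⟩ | ⟨i, j⟩ | _) hs (⟨j', i'⟩ | ⟨i', j'⟩ | _) ht h
  all_goals
    simp only [hypIdx, inl_mem_disjSum, inr_mem_disjSum, mem_sigma, mem_range, mem_product,
      mem_Ico] at hs ht
    have h' := fun (v : ℕ) (hv : v < n + 1) => Finset.ext_iff.1 h ⟨v, hv⟩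
    simp only [hypSet, Sum.elim_inl, Sum.elim_inr, mem_filter, mem_univ, true_and] at h'
  · have e1 := h' i (by omega)
    have e2 := h' i' (by omega)
    have e3 := h' (j - 1) (by omega)
    have e4 := h' (j' - 1) (by omega)
    obtain rfl : i = i' := by omega
    obtain rfl : j = j' := by omega
    rfl
  · have e1 := h' n (by omega)
    omega
  · have e1 := h' n (by omega)
    omega
  · have e1 := h' n (by omega)
    omega
  · have e1 := h' i (by omega)
    have e2 := h' i' (by omega)
    have e3 := h' (j - 1) (by omega)
    have e4 := h' (j' - 1) (by omega)
    obtain rfl : i = i' := by omega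
    obtain rfl : j = j' := by omega
    rfl
  · have e1 := h' i (by omega)
    omega
  · have e1 := h' n (by omega)
    omega
  · have e1 := h' i' (by omega)
    omega
  · rfl

lemma hypIdx_card (n k : ℕ) : (hypIdx n k).card = ∑ j ∈ range (n + 1), j + (k * (n + 1 - k) + 1) := by
  simp [hypIdx, card_disjSum, card_sigma]

open Polynomial in
lemma rowH_A {n k : ℕ} (A H W : Polynomial (MvPolynomial (Fin (n + 1)) ℚ))
    (hA : A = ∏ i ∈ range k, (X - C (yv n i)))
    (hH : H.comp (X + C (xv n n)) - H = C (xv n n) * (W * A.comp (X + C (xv n n)))) :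
    ∀ i j, i < k → k ≤ j → j ≤ n →
      yv n j - yv n i + xv n n ∣ H.eval (yv n j) - H.eval (yv n i) := by
  intro i j hi hj hjn
  have e := congrArg (eval (yv n j)) hH
  simp only [eval_sub, eval_comp, eval_mul, eval_add, eval_X, eval_C] at e
  have e1 : yv n j - yv n i + xv n n ∣ eval (yv n j + xv n n) A := by
    rw [hA, eval_prod]
    refine dvd_trans ?_ (dvd_prod_of_mem _ (mem_range.2 hi))
    simp only [eval_sub, eval_X, eval_C]
    exact dvd_of_eq (by ring)
  have e2 : yv n j - yv n i + xv n n ∣ H.eval (yv n j + xv n n) - H.eval (yv n i) := by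
    refine dvd_trans (dvd_of_eq ?_) (sub_dvd_eval_sub (yv n j + xv n n) (yv n i) H)
    ring
  have e3 : H.eval (yv n j) - H.eval (yv n i) = (H.eval (yv n j + xv n n) - H.eval (yv n i)) -
      (xv n n * W.eval (yv n j)) * eval (yv n j + xv n n) A := by
    linear_combination -e
  rw [e3]
  exact dvd_sub e2 (e1.mul_left _)

open Polynomial in
lemma rowH_B {n k : ℕ} (B H W : Polynomial (MvPolynomial (Fin (n + 1)) ℚ))
    (hB : B = ∏ i ∈ Ico k (n + 1), (X - C (yv n i)))
    (hH : H.comp (X + C (xv n n)) - H = C (xv n n) * (W * B)) :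
    ∀ i j, i < k → k ≤ j → j ≤ n →
      yv n j - yv n i + xv n n ∣ H.eval (yv n j) - H.eval (yv n i) := by
  intro i j hi hj hjn
  have e := congrArg (eval (yv n j)) hH
  simp only [eval_sub, eval_comp, eval_mul, eval_add, eval_X, eval_C] at e
  have e1 : eval (yv n j) B = 0 := by
    rw [hB, eval_prod]
    exact prod_eq_zero (mem_Ico.2 ⟨hj, by omega⟩) (by simp)
  rw [e1, mul_zero, mul_zero, sub_eq_zero] at e
  rw [← e]
  refine dvd_trans (dvd_of_eq ?_) (sub_dvd_eval_sub (yv n j + xv n n) (yv n i) H)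
  ring

open Polynomial in
lemma exists_H {n k : ℕ} (h1 : 1 < k) (h2 : k < n)
    (A B : Polynomial (MvPolynomial (Fin (n + 1)) ℚ))
    (hA : A = ∏ i ∈ range k, (X - C (yv n i)))
    (hB : B = ∏ i ∈ Ico k (n + 1), (X - C (yv n i))) (l : ℕ) :
    ∃ H : Polynomial (MvPolynomial (Fin (n + 1)) ℚ),
      Wt (l + 1 + if l < n + 1 - k then k else 0) H ∧
      (l < n + 1 - k → H.comp (X + C (xv n n)) - H
        = C (xv n n) * (X ^ l * A.comp (X + C (xv n n)))) ∧
      (n + 1 - k ≤ l → H.comp (X + C (xv n n)) - H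
        = C (xv n n) * (X ^ (l - (n + 1 - k)) * B)) := by
  by_cases hl : l < n + 1 - k
  · have hAc : A.comp (X + C (xv n n)) = ∏ i ∈ range k, (X - C (yv n i - xv n n)) := by
      rw [hA, Polynomial.prod_comp]
      apply Finset.prod_congr rfl
      intro i _
      simp
      ring
    have hW : Wt k (A.comp (X + C (xv n n))) := by
      rw [hAc]
      have := Wt.prod_X_sub_C (range k) (fun i => yv n i - xv n n) (fun i _ =>
        (MvPolynomial.totalDegree_sub _ _).trans (max_le (yv_degree _ _) (xv_degree _ _)))
      simpa using this
    obtain ⟨H, hH1, hH2⟩ := exists_antidiff (xv n n) (xv_degree _ _) _ _ ((Wt.Xpow l).mul hW)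
    refine ⟨H, ?_, fun _ => hH2, fun h => absurd hl (by omega)⟩
    rw [if_pos hl]
    exact hH1.mono (by omega)
  · have hW : Wt (n + 1 - k) B := by
      rw [hB]
      have := Wt.prod_X_sub_C (Ico k (n + 1)) (fun i => yv n i) (fun i _ => yv_degree _ _)
      simpa using this
    obtain ⟨H, hH1, hH2⟩ := exists_antidiff (xv n n) (xv_degree _ _) _ _
      ((Wt.Xpow (l - (n + 1 - k))).mul hW)
    refine ⟨H, ?_, fun h => absurd h hl, fun _ => hH2⟩
    exact hH1.mono (by omega)

/-- For `1 < k < n`, the connected subgraph arrangement of the almost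
path graph `A_{n,k}` (on the `n+1` vertices `[n+1]`) is free: its module of
`𝒜_{A_{n,k}}`-derivations is a free module over `ℚ[x_1,…,x_{n+1}]`. -/
theorem csa_almostPath_free (n k : ℕ) (h1 : 1 < k) (h2 : k < n) :
    Module.Free (MvPolynomial (Fin (n + 1)) ℚ) (derModule (almostPath n k)) := by
  classical
  obtain ⟨A, hA⟩ : ∃ A, A = ∏ i ∈ range k, (Polynomial.X - Polynomial.C (yv n i)) := ⟨_, rfl⟩
  obtain ⟨B, hB⟩ : ∃ B, B = ∏ i ∈ Ico k (n + 1), (Polynomial.X - Polynomial.C (yv n i)) :=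
    ⟨_, rfl⟩
  choose H hHW hHA hHB using exists_H h1 h2 A B hA hB
  have hz0 : xv n n ≠ 0 := by
    have := xv_val (Fin.last n)
    rw [Fin.val_last] at this
    rw [this]
    exact MvPolynomial.X_ne_zero _
  set M : Matrix (Fin (n + 1)) (Fin (n + 1)) (MvPolynomial (Fin (n + 1)) ℚ) :=
    fun l v => if l.val < n then rowH n (H l.val) v.val else xv n v.val with hM
  have hMl : ∀ l : Fin (n + 1), l.val < n → M l = fun v => rowH n (H l.val) v.val := by
    intro l hl
    ext1 v
    simp only [hM, if_pos hl]
  have hMn : ∀ l : Fin (n + 1), ¬ l.val < n → M l = fun v => MvPolynomial.X v := by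
    intro l hl
    ext1 v
    simp only [hM, if_neg hl, xv_val]
  refine saito (hypIdx n k) (hypSet n) (hypSet_conn h1 h2) (hypSet_inj h1 h2) M ?_ ?_
    (fun l => if l.val < n then (l.val + 1 + if l.val < n + 1 - k then k else 0) else 1) ?_ ?_
  · intro l
    by_cases hl : l.val < n
    · rw [hMl l hl]
      apply rowH_mem h1 h2
      by_cases hlq : l.val < n + 1 - k
      · exact rowH_A A _ _ hA (hHA _ hlq)
      · exact rowH_B B _ _ hB (hHB _ (by omega))
    · rw [hMn l hl]
      intro I _
      rw [map_sum]
      simp only [MvPolynomial.mkDerivation_X]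
      exact dvd_refl _
  · intro hdet
    obtain ⟨v, hv0, hv⟩ := Matrix.exists_vecMul_eq_zero_iff.2 hdet
    have hsum : ∀ i : Fin (n + 1), ∑ l : Fin n, v l.castSucc * rowH n (H l.val) i.val
        + v (Fin.last n) * xv n i.val = 0 := by
      intro i
      have := congrFun hv i
      simp only [Matrix.vecMul, dotProduct, Fin.sum_univ_castSucc, Pi.zero_apply, hM] at this
      simpa using this
    have hvn : v (Fin.last n) = 0 := by
      have := hsum (Fin.last n)
      simpa [rowH, hz0] using this
    set v' : ℕ → MvPolynomial (Fin (n + 1)) ℚ :=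
      fun l => if h : l < n + 1 then v ⟨l, h⟩ else 0 with hv'
    have hv'0 := indep_aux (xv n n) hz0 n k h1 h2 (yv n) yv_inj (by
      intro i hi j hj hjn h
      apply yv_ne' (n := n) (i := i) (j := j) (by omega) hjn
      rw [← h]; ring) A B hA hB H
      (fun l hl => (hHW l).natDegree_le.trans (by split_ifs <;> omega))
      (fun l hl => hHA l hl) (fun l hl _ => hHB l hl) v' (by
        intro i hi
        have := hsum ⟨i, by omega⟩
        rw [hvn, zero_mul, add_zero] at this
        rw [← this, Finset.sum_range]
        apply Finset.sum_congr rfl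
        intro l _
        have e1 : v' l.val = v l.castSucc := by
          simp only [hv']
          rw [dif_pos (by omega)]
          rfl
        rw [e1, rowH, if_pos hi])
    apply hv0
    ext1 l
    by_cases hl : l.val < n
    · have := hv'0 l.val hl
      simp only [hv'] at this
      rw [dif_pos l.2] at this
      exact this
    · have : l = Fin.last n := Fin.ext (by have := l.2; simp; omega)
      rw [this, hvn]; rfl
  · intro l i
    by_cases hl : l.val < n
    · rw [hMl l hl]
      simp only [if_pos hl, rowH]
      split_ifs
      all_goals first
        | (simp; done)
        | skip
      all_goals
        have e := hHW l.val
        refine (MvPolynomial.totalDegree_sub _ _).trans (max_le ?_ ?_)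
        all_goals
          refine (e.eval (yv_degree _ _)).trans ?_
          split_ifs <;> omega
    · rw [hMn l hl]
      simp [if_neg hl]
  · rw [hypIdx_card, Fin.sum_univ_eq_sum_range
      (fun l => if l < n then (l + 1 + if l < n + 1 - k then k else 0) else 1) (n + 1),
      sum_range_succ, if_neg (lt_irrefl n), ← add_assoc]
    have e1 : ∑ l ∈ range n, (if l < n then (l + 1 + if l < n + 1 - k then k else 0) else 1)
        = ∑ l ∈ range n, (l + 1) + ∑ l ∈ range n, (if l < n + 1 - k then k else 0) := by
      rw [← sum_add_distrib]
      apply sum_congr rfl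
      intro l hl
      rw [if_pos (mem_range.1 hl)]
    have e2 : ∑ l ∈ range n, (if l < n + 1 - k then k else 0) = k * (n + 1 - k) := by
      rw [← sum_filter, sum_const, smul_eq_mul, mul_comm]
      congr 1
      have : (range n).filter (fun l => l < n + 1 - k) = range (n + 1 - k) := by
        ext l
        simp only [mem_filter, mem_range]
        omega
      rw [this, card_range]
    rw [e1, e2, sum_range_succ' (fun j => j) n, add_zero]
end
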